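/- Let K be a fully Hilbertian field of cardinality m, A a finite abelian group, L/K a finite Galois extension with group G acting on A. Then the profinite group A^m ⋊ G (with G acting coordinatewise on the product of m copies of A) occurs as a Galois group over K. In particular, A^m occurs as a Galois group over K. -/

import Mathlib

open Polynomial

/-- The Hilbert set of `f(X,Y) ∈ K[X][Y]` (with `Y` the outer variable). -/
def HilbertSet {K : Type} [Field K] (f : Polynomial (Polynomial K)) : Set K :=
  {a : K | Irreducible (f.map (Polynomial.evalRingHom a))}

/-- `K` is fully Hilbertian (equivalent characterization by absolutely irreducible
polynomials). -/
def IsFullyHilbertian (K : Type) [Field K] : Prop :=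
  ∀ f : Polynomial (Polynomial K),
    Irreducible (f.map (Polynomial.mapRingHom (algebraMap K (AlgebraicClosure K)))) →
    f.derivative ≠ 0 →
    ∃ (A : Set K) (b : A → AlgebraicClosure K),
      A ⊆ HilbertSet f ∧ Cardinal.mk A = Cardinal.mk K ∧
      (∀ a : A, Polynomial.aeval (b a) (f.map (Polynomial.evalRingHom (a : K))) = 0) ∧
      (∀ a : A,
        (IntermediateField.adjoin K {b a}).LinearDisjoint
          ↥(⨆ (a' : A) (_ : a' ≠ a), IntermediateField.adjoin K {b a'}))

/-- The coordinatewise action of `G` on `ι → A` induced by an action `φ₀ : G →* MulAut A`. -/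
def piAut {G A : Type} (ι : Type) [Group G] [Group A] (φ₀ : G →* MulAut A) :
    G →* MulAut (ι → A) where
  toFun g := MulEquiv.piCongrRight fun _ : ι => φ₀ g
  map_one' := by
    ext f i
    simp
  map_mul' g h := by
    ext f i
    simp

/-- The profinite topology on the semidirect product `(ι → A) ⋊ G` of the (discrete-`A`)
product group `ι → A` with the Galois group `G = Gal(L/K)` (Krull topology):
the topology induced from the product. -/
def sdTop {K L A : Type} [Field K] [Field L] [Algebra K L] [Group A] (ι : Type)
    (φ : (L ≃ₐ[K] L) →* MulAut (ι → A)) :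
    TopologicalSpace ((ι → A) ⋊[φ] (L ≃ₐ[K] L)) :=
  TopologicalSpace.induced (fun p => (p.left, p.right))
    (@instTopologicalSpaceProd _ _
      (@Pi.topologicalSpace ι (fun _ => A) (fun _ => ⊥)) (krullTopology K L))

/-- A family of homomorphisms `ψ i : N → B` on a normal subgroup `N` of `Γ` such that the
conjugates of any finite subfamily under coset representatives are jointly surjective. -/
def ConjIndependent {Γ I B : Type*} [Group Γ] (N : Subgroup Γ) [N.Normal] [Group B]
    (ψ : I → N →* B) : Prop :=
  ∀ (S : Finset I) (β : I → Γ ⧸ N → B), ∃ τ : N, ∀ i ∈ S, ∀ q : Γ ⧸ N,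
    ψ i (MulAut.conjNormal q.out⁻¹ τ) = β i q

theorem conjIndependent_of_relIndex {Γ I B : Type*} [Group Γ] {N : Subgroup Γ} [N.Normal]
    [N.FiniteIndex] [Group B] [Finite B] (ψ : I → N →* B) (U : I → Subgroup Γ)
    (hU : ∀ S : Finset I,
      (⨅ i ∈ S, U i).relIndex N = (Nat.card B ^ Nat.card (Γ ⧸ N)) ^ S.card)
    (hker : ∀ i (τ : N), (∀ q : Γ ⧸ N, ψ i (MulAut.conjNormal q.out⁻¹ τ) = 1) → (τ : Γ) ∈ U i) :
    ConjIndependent N ψ := by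
  intro S β
  let Φ : N →* (S → Γ ⧸ N → B) := MonoidHom.mk' (fun τ i q ↦ ψ i (MulAut.conjNormal q.out⁻¹ τ))
    (by intro a b; ext i q; simp)
  have hle : Φ.ker ≤ (⨅ i ∈ S, U i).subgroupOf N := by
    intro τ hτ
    simp only [Subgroup.mem_subgroupOf, Subgroup.mem_iInf]
    intro i hi
    exact hker i τ fun q ↦ congrFun (congrFun hτ ⟨i, hi⟩) q
  have hfin : Finite Φ.range := inferInstance
  have h1 : Nat.card (S → Γ ⧸ N → B) = (Nat.card B ^ Nat.card (Γ ⧸ N)) ^ S.card := by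
    rw [Nat.card_fun, Nat.card_fun]
    simp
  have h2 : (⨅ i ∈ S, U i).relIndex N ≤ Φ.ker.index := by
    have : Φ.ker.index ≠ 0 := by
      rw [Subgroup.index_ker]; exact Nat.card_pos.ne'
    have : Φ.ker.FiniteIndex := ⟨this⟩
    exact Subgroup.index_antitone hle
  rw [hU, Subgroup.index_ker, ← h1] at h2
  have htop : Φ.range = ⊤ := Subgroup.eq_top_of_le_card _ h2
  obtain ⟨τ, hτ⟩ := MonoidHom.range_eq_top.mp htop fun i q ↦ β i q
  exact ⟨τ, fun i hi q ↦ congrFun (congrFun hτ ⟨i, hi⟩) q⟩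

theorem exists_finset_relIndex_eq {Γ T : Type*} [Group Γ] (N : Subgroup Γ)
    [N.FiniteIndex] (U : T → Subgroup Γ) {D : ℕ} (hD : 0 < D)
    (hU : ∀ S : Finset T, (⨅ i ∈ S, U i).index = D ^ S.card) :
    ∃ S₀ : Finset T, ∀ S : Finset T, Disjoint S₀ S →
      (⨅ i ∈ S, U i).relIndex N = D ^ S.card := by
  classical
  let W : Finset T → Subgroup Γ := fun S ↦ ⨅ i ∈ S, U i
  have hWindex : ∀ S, (W S).index = D ^ S.card := hU
  have hWanti : ∀ {S S'}, S ⊆ S' → W S' ≤ W S := fun h ↦ biInf_mono h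
  have hWfin : ∀ S, (W S).FiniteIndex := fun S ↦ ⟨by rw [hWindex]; positivity⟩
  obtain ⟨S₀, hS₀⟩ : ∃ S₀, ∀ S, N.relIndex (W S₀) ≤ N.relIndex (W S) :=
    ⟨Function.argmin (fun S ↦ N.relIndex (W S)), fun S ↦
      Function.argmin_le (fun S ↦ N.relIndex (W S)) S⟩
  refine ⟨S₀, fun S hS ↦ ?_⟩
  change (W S).relIndex N = _
  have hunion : W (S₀ ∪ S) = W S₀ ⊓ W S := Finset.iInf_union
  have hcard : (S₀ ∪ S).card = S₀.card + S.card := Finset.card_union_of_disjoint hS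
  have hne : N.relIndex (W S₀) ≠ 0 := fun h ↦
    (Subgroup.FiniteIndex.index_ne_zero (H := N)) (Subgroup.index_eq_zero_of_relIndex_eq_zero h)
  have hm : N.relIndex (W (S₀ ∪ S)) = N.relIndex (W S₀) :=
    le_antisymm (Subgroup.relIndex_le_of_le_right (hWanti Finset.subset_union_left) hne) (hS₀ _)
  have e1 : (N ⊓ W S₀).index = N.relIndex (W S₀) * D ^ S₀.card := by
    rw [← Subgroup.relIndex_mul_index (inf_le_right : N ⊓ W S₀ ≤ W S₀),
      Subgroup.inf_relIndex_right, hWindex]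
  have e2 : (N ⊓ W (S₀ ∪ S)).index = N.relIndex (W S₀) * D ^ (S₀.card + S.card) := by
    rw [← Subgroup.relIndex_mul_index (inf_le_right : N ⊓ W (S₀ ∪ S) ≤ W (S₀ ∪ S)),
      Subgroup.inf_relIndex_right, hWindex, hm, hcard]
  have e3 : (W S).relIndex (N ⊓ W S₀) * (N ⊓ W S₀).index = (N ⊓ W (S₀ ∪ S)).index := by
    rw [← Subgroup.inf_relIndex_right, Subgroup.relIndex_mul_index inf_le_right, hunion]
    congr 1
    ac_rfl
  have e4 : (W S).relIndex (N ⊓ W S₀) = D ^ S.card := by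
    rw [e1, e2, pow_add] at e3
    refine Nat.eq_of_mul_eq_mul_right (Nat.pos_of_ne_zero
      (mul_ne_zero hne (pow_pos hD S₀.card).ne')) (e3.trans (by ring))
  have hneN : (W S).relIndex N ≠ 0 := fun h ↦
    (hWfin S).index_ne_zero (Subgroup.index_eq_zero_of_relIndex_eq_zero h)
  refine le_antisymm ?_ ?_
  · rw [← hWindex, ← Subgroup.relIndex_top_right]
    exact Subgroup.relIndex_le_of_le_right le_top (by simpa using (hWfin S).index_ne_zero)
  · rw [← e4]
    exact Subgroup.relIndex_le_of_le_right inf_le_left hneN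

/-- Nakayama's lemma for subgroups of `(ZMod m) ^ J`. -/
theorem AddSubgroup.eq_top_of_forall_prime {J : Type*} {m : ℕ} (hm : m ≠ 0)
    (H : AddSubgroup (J → ZMod m))
    (h : ∀ ℓ : ℕ, ℓ.Prime → ℓ ∣ m → ∀ x : J → ZMod m, ∃ y ∈ H, ∃ z, x = y + ℓ • z) : H = ⊤ := by
  have key : ∀ d : ℕ, d ∣ m → ∀ x : J → ZMod m, ∃ y ∈ H, ∃ z, x = y + d • z := by
    intro d
    induction d using Nat.recOnMul with
    | zero => intro h0; exact absurd (zero_dvd_iff.mp h0) hm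
    | one => intro _ x; exact ⟨0, H.zero_mem, x, by simp⟩
    | prime p hp => exact h p hp
    | mul a b ha hb =>
      intro hab x
      obtain ⟨y, hy, z, rfl⟩ := ha (dvd_of_mul_right_dvd hab) x
      obtain ⟨y', hy', z', rfl⟩ := hb (dvd_of_mul_left_dvd hab) z
      exact ⟨y + a • y', H.add_mem hy (H.nsmul_mem hy' a), z', by
        rw [smul_add, add_assoc, mul_smul]⟩
  rw [eq_top_iff]
  intro x _
  obtain ⟨y, hy, z, rfl⟩ := key m dvd_rfl x
  have : m • z = 0 := by
    ext j
    simp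
  rwa [this, add_zero]

/-- Surjectivity onto `(ZMod m) ^ J` may be tested modulo the primes dividing `m`. -/
theorem exists_eq_of_forall_prime {H J : Type*} [Group H] {m : ℕ} (hm : m ≠ 0)
    (f : H →* (J → Multiplicative (ZMod m)))
    (h : ∀ ℓ : ℕ, ℓ.Prime → (hℓ : ℓ ∣ m) → ∀ x : J → ZMod ℓ, ∃ τ : H, ∀ j,
      ZMod.castHom hℓ (ZMod ℓ) (f τ j).toAdd = x j) :
    Function.Surjective f := by
  let R : AddSubgroup (J → ZMod m) :=
    { carrier := {v | ∃ τ, ∀ j, (f τ j).toAdd = v j}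
      zero_mem' := ⟨1, by simp⟩
      add_mem' := by
        rintro a b ⟨s, hs⟩ ⟨t, ht⟩
        exact ⟨s * t, fun j ↦ by simp [hs, ht]⟩
      neg_mem' := by
        rintro a ⟨s, hs⟩
        exact ⟨s⁻¹, fun j ↦ by simp [hs]⟩ }
  have hR : R = ⊤ := by
    refine AddSubgroup.eq_top_of_forall_prime hm R fun ℓ hℓ hd x ↦ ?_
    obtain ⟨τ, hτ⟩ := h ℓ hℓ hd fun j ↦ ZMod.castHom hd (ZMod ℓ) (x j)
    have : ∀ j, ∃ z : ZMod m, x j - (f τ j).toAdd = ℓ • z := by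
      intro j
      have hz : ZMod.castHom hd (ZMod ℓ) (x j - (f τ j).toAdd) = 0 := by
        rw [map_sub, hτ, sub_self]
      have : NeZero m := ⟨hm⟩
      obtain ⟨k, hk⟩ : ∃ k : ℕ, (k : ZMod m) = x j - (f τ j).toAdd :=
        ⟨_, ZMod.natCast_zmod_val _⟩
      rw [← hk, map_natCast, ZMod.natCast_eq_zero_iff] at hz
      obtain ⟨c, rfl⟩ := hz
      exact ⟨c, by rw [← hk]; simp⟩
    choose z hz using this
    exact ⟨fun j ↦ (f τ j).toAdd, ⟨τ, fun j ↦ rfl⟩, z, by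
      ext j
      simp only [Pi.add_apply, Pi.smul_apply]
      rw [← hz]; ring⟩
  intro v
  obtain ⟨τ, hτ⟩ : (fun j ↦ (v j).toAdd) ∈ R := hR ▸ AddSubgroup.mem_top _
  exact ⟨τ, funext fun j ↦ hτ j⟩

theorem ConjIndependent.of_castHom {Γ I : Type*} [Group Γ] {N : Subgroup Γ} [N.Normal]
    {p r : ℕ} (hp : p.Prime) (hr : p ∣ p ^ r) (ψ : I → N →* Multiplicative (ZMod (p ^ r)))
    (ψ₁ : I → N →* Multiplicative (ZMod p)) (h₁ : ConjIndependent N ψ₁)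
    (h : ∀ i τ, ZMod.castHom hr (ZMod p) (ψ i τ).toAdd = (ψ₁ i τ).toAdd) :
    ConjIndependent N ψ := by
  intro S β
  let Φ : N →* (S × (Γ ⧸ N) → Multiplicative (ZMod (p ^ r))) :=
    MonoidHom.mk' (fun τ j ↦ ψ j.1 (MulAut.conjNormal j.2.out⁻¹ τ)) (by intro a b; ext; simp)
  have hsurj : Function.Surjective Φ := by
    refine exists_eq_of_forall_prime (pow_ne_zero _ hp.ne_zero) Φ fun ℓ hℓ hd x ↦ ?_
    obtain rfl : ℓ = p := (Nat.prime_dvd_prime_iff_eq hℓ hp).mp (hℓ.dvd_of_dvd_pow hd)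
    classical
    obtain ⟨τ, hτ⟩ := h₁ S fun i q ↦
      if hi : i ∈ S then Multiplicative.ofAdd (x (⟨i, hi⟩, q)) else 1
    refine ⟨τ, fun j ↦ ?_⟩
    change ZMod.castHom hd (ZMod ℓ) (ψ j.1 _).toAdd = _
    rw [h, hτ j.1 j.1.2]
    simp
  obtain ⟨τ, hτ⟩ := hsurj fun j ↦ β j.1 j.2
  exact ⟨τ, fun i hi q ↦ congrFun hτ (⟨i, hi⟩, q)⟩

theorem ConjIndependent.chineseRemainder {Γ I : Type*} [Group Γ] {N : Subgroup Γ} [N.Normal]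
    {m₁ m₂ : ℕ} (hm : m₁.Coprime m₂) (ψ₁ : I → N →* Multiplicative (ZMod m₁))
    (ψ₂ : I → N →* Multiplicative (ZMod m₂)) (h₁ : ConjIndependent N ψ₁)
    (h₂ : ConjIndependent N ψ₂) :
    ConjIndependent N fun i ↦
      (AddMonoidHom.toMultiplicative
        ((ZMod.chineseRemainder hm).symm : ZMod m₁ × ZMod m₂ →+ ZMod (m₁ * m₂))).comp
      ((MulEquiv.prodMultiplicative (G := ZMod m₁) (H := ZMod m₂)).symm.toMonoidHom.comp
        ((ψ₁ i).prod (ψ₂ i))) := by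
  intro S β
  let c := ZMod.chineseRemainder hm
  obtain ⟨τ₁, hτ₁⟩ := h₁ S fun i q ↦ Multiplicative.ofAdd (c (β i q).toAdd).1
  obtain ⟨τ₂, hτ₂⟩ := h₂ S fun i q ↦ Multiplicative.ofAdd (c (β i q).toAdd).2
  obtain ⟨u, hu₁, hu₂⟩ := Nat.chineseRemainder hm 1 0
  obtain ⟨v, hv₁, hv₂⟩ := Nat.chineseRemainder hm 0 1
  rw [← ZMod.natCast_eq_natCast_iff] at hu₁ hu₂ hv₁ hv₂
  refine ⟨τ₁ ^ u * τ₂ ^ v, fun i hi q ↦ ?_⟩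
  apply Multiplicative.toAdd.injective
  apply c.injective
  have e₁ : (ψ₁ i (MulAut.conjNormal q.out⁻¹ (τ₁ ^ u * τ₂ ^ v))).toAdd
      = (c (β i q).toAdd).1 := by
    rw [map_mul, map_pow, map_pow, map_mul, map_pow, map_pow, hτ₁ i hi q]
    simp [hu₁, hv₁]
  have e₂ : (ψ₂ i (MulAut.conjNormal q.out⁻¹ (τ₁ ^ u * τ₂ ^ v))).toAdd
      = (c (β i q).toAdd).2 := by
    rw [map_mul, map_pow, map_pow, map_mul, map_pow, map_pow, hτ₂ i hi q]
    simp [hu₂, hv₂]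
  change c (c.symm (_, _)) = _
  rw [RingEquiv.apply_symm_apply]
  exact Prod.ext e₁ e₂

section Corestriction

variable {Γ A : Type*} [Group Γ] [CommGroup A]

theorem out_inv_mul_mul_out_mem (N : Subgroup Γ) (τ : Γ) (q : Γ ⧸ N) :
    (τ • q).out⁻¹ * τ * q.out ∈ N := by
  rw [mul_assoc, ← QuotientGroup.eq, QuotientGroup.out_eq']
  conv_lhs => rw [← QuotientGroup.out_eq' q]
  rfl

/-- The corestriction of a homomorphism `χ : N → A` to a crossed homomorphism `Γ → A`. -/
noncomputable def corestriction (N : Subgroup Γ) [Fintype (Γ ⧸ N)] (ρ : Γ →* MulAut A)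
    (χ : N →* A) (τ : Γ) : A :=
  ∏ q : Γ ⧸ N, ρ (τ • q).out (χ ⟨_, out_inv_mul_mul_out_mem N τ q⟩)

variable {N : Subgroup Γ} [Fintype (Γ ⧸ N)] {ρ : Γ →* MulAut A} (χ : N →* A)

theorem corestriction_mul (hρ : N ≤ ρ.ker) (τ υ : Γ) :
    corestriction N ρ χ (τ * υ) = corestriction N ρ χ τ * ρ τ (corestriction N ρ χ υ) := by
  have hτ : corestriction N ρ χ τ =
      ∏ q : Γ ⧸ N, ρ (τ • υ • q).out (χ ⟨_, out_inv_mul_mul_out_mem N τ (υ • q)⟩) :=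
    (Equiv.prod_comp (MulAction.toPerm υ : Equiv.Perm (Γ ⧸ N)) fun q ↦
      ρ (τ • q).out (χ ⟨_, out_inv_mul_mul_out_mem N τ q⟩)).symm
  rw [hτ, corestriction, corestriction, map_prod, ← Finset.prod_mul_distrib]
  refine Finset.prod_congr rfl fun q _ ↦ ?_
  have h1 : ρ τ * ρ (υ • q).out = ρ (τ • υ • q).out := by
    have := hρ (out_inv_mul_mul_out_mem N τ (υ • q))
    rw [MonoidHom.mem_ker, map_mul, map_mul, map_inv, mul_assoc, inv_mul_eq_one] at this
    exact this.symm
  have h2 : (⟨_, out_inv_mul_mul_out_mem N (τ * υ) q⟩ : N) =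
      ⟨_, out_inv_mul_mul_out_mem N τ (υ • q)⟩ * ⟨_, out_inv_mul_mul_out_mem N υ q⟩ := by
    ext
    simp only [mul_smul, Subgroup.coe_mul]
    group
  rw [h2, map_mul, map_mul, mul_smul, ← h1]
  rfl

theorem corestriction_coe [N.Normal] (τ : N) :
    corestriction N ρ χ τ = ∏ q : Γ ⧸ N, ρ q.out (χ (MulAut.conjNormal q.out⁻¹ τ)) := by
  refine Finset.prod_congr rfl fun q _ ↦ ?_
  have h : (τ : Γ) • q = q := by
    induction q using QuotientGroup.induction_on with
    | H g =>
      change ((τ * g : Γ) : Γ ⧸ N) = g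
      rw [eq_comm, QuotientGroup.eq, ← mul_assoc]
      simpa using ‹N.Normal›.conj_mem τ τ.2 g⁻¹
  have h' : (⟨_, out_inv_mul_mul_out_mem N τ q⟩ : N) = MulAut.conjNormal q.out⁻¹ τ := by
    apply Subtype.ext
    rw [MulAut.conjNormal_apply, inv_inv]
    change ((τ : Γ) • q).out⁻¹ * _ * _ = _
    rw [h]
  rw [h', h]

theorem exists_corestriction_eq [N.Normal] {I : Type*} (χ : I → N →* A)
    (hχ : ConjIndependent N χ) (S : Finset I) (α : I → A) :
    ∃ τ : N, ∀ i ∈ S, corestriction N ρ (χ i) τ = α i := by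
  classical
  obtain ⟨τ, hτ⟩ := hχ S fun i q ↦ if q = ((1 : Γ) : Γ ⧸ N) then (ρ q.out)⁻¹ (α i) else 1
  refine ⟨τ, fun i hi ↦ ?_⟩
  rw [corestriction_coe, Finset.prod_eq_single ((1 : Γ) : Γ ⧸ N)]
  · rw [hτ i hi, if_pos rfl]
    simp
  · intro q _ hq
    rw [hτ i hi, if_neg hq, map_one]
  · simp

end Corestriction

/-- From independent characters with values in `ZMod n` to independent homomorphisms
with values in an abelian group killed by `n`. -/
theorem ConjIndependent.exists_of_zmod {Γ I A : Type*} [Group Γ] {N : Subgroup Γ} [N.Normal]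
    [CommGroup A] [Finite A] {n : ℕ} (hn : ∀ x : A, x ^ n = 1)
    (ψ : I × A → N →* Multiplicative (ZMod n)) (hψ : ConjIndependent N ψ) :
    ∃ χ : I → N →* A, ConjIndependent N χ ∧
      ∀ i τ, (∀ a, ψ (i, a) τ = 1) → χ i τ = 1 := by
  classical
  have := Fintype.ofFinite A
  let f (a : A) : { f : ℤ →+ Additive A // f n = 0 } :=
    ⟨zmultiplesHom (Additive A) (Additive.ofMul a), by
      simpa using congrArg Additive.ofMul (hn a)⟩
  let pw (a : A) : Multiplicative (ZMod n) →* A := (ZMod.lift n (f a)).toMultiplicativeLeft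
  have hpw (a : A) : pw a (Multiplicative.ofAdd 1) = a := by
    have h : ZMod.lift n (f a) 1 = Additive.ofMul a := by
      rw [← Int.cast_one, ZMod.lift_coe]
      simp [f]
    exact congrArg Additive.toMul h
  refine ⟨fun i ↦ ∏ a : A, (pw a).comp (ψ (i, a)), fun S β ↦ ?_, fun i τ h ↦ ?_⟩
  · obtain ⟨τ, hτ⟩ := hψ (S ×ˢ Finset.univ) fun j q ↦
      if j.2 = β j.1 q then Multiplicative.ofAdd 1 else 1
    refine ⟨τ, fun i hi q ↦ ?_⟩
    rw [MonoidHom.finsetProd_apply, Finset.prod_eq_single (β i q)]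
    · rw [MonoidHom.comp_apply, hτ (i, _) (by simpa using hi), if_pos rfl, hpw]
    · intro a _ ha
      rw [MonoidHom.comp_apply, hτ (i, a) (by simpa using hi), if_neg ha, map_one]
    · simp
  · rw [MonoidHom.finsetProd_apply]
    exact Finset.prod_eq_one fun a _ ↦ by rw [MonoidHom.comp_apply, h a, map_one]

open IntermediateField in
theorem fixingSubgroup_adjoin_simple {K E : Type*} [Field K] [Field E] [Algebra K E] (b : E) :
    K⟮b⟯.fixingSubgroup = MulAction.stabilizer (E ≃ₐ[K] E) b := by
  ext τ
  rw [IntermediateField.mem_fixingSubgroup_iff]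
  refine ⟨fun h ↦ h b (mem_adjoin_simple_self K b), fun h x hx ↦ ?_⟩
  have : K⟮b⟯ ≤ fixedField (Subgroup.zpowers τ) := by
    rw [adjoin_simple_le_iff, mem_fixedField_iff]
    intro f hf
    exact (Subgroup.zpowers_le.mpr h : Subgroup.zpowers τ ≤ MulAction.stabilizer (E ≃ₐ[K] E) b) hf
  exact (mem_fixedField_iff _ _).mp (this hx) τ (Subgroup.mem_zpowers τ)

theorem finrank_biSup_of_linearDisjoint {K E T : Type*} [Field K] [Field E] [Algebra K E]
    (F : T → IntermediateField K E) {D : ℕ} (hD : ∀ i, Module.finrank K (F i) = D)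
    (h : ∀ i, (F i).LinearDisjoint ↥(⨆ (j : T) (_ : j ≠ i), F j)) (S : Finset T) :
    Module.finrank K ↥(⨆ i ∈ S, F i) = D ^ S.card := by
  classical
  induction S using Finset.induction_on with
  | empty => simp
  | insert i S hi ih =>
    rw [Finset.iSup_insert, Finset.card_insert_of_notMem hi, pow_succ', ← ih, ← hD i]
    refine ((h i).of_le_right (iSup₂_le fun j hj ↦ ?_)).finrank_sup
    exact le_iSup₂_of_le j (fun hji ↦ hi (hji ▸ hj)) le_rfl

/-- The Hilbert property yields, over a given finite index subgroup of the absolute Galois group,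
`|K|` independent specializations. -/
theorem IsFullyHilbertian.exists_relIndex_eq {K : Type} [Field K] [Infinite K]
    (hK : IsFullyHilbertian K) (N : Subgroup (SeparableClosure K ≃ₐ[K] SeparableClosure K))
    [N.FiniteIndex] {I : Type} (hI : Cardinal.mk I = Cardinal.mk K) (f : K[X][X])
    (hmonic : f.Monic)
    (hirr : Irreducible (f.map (mapRingHom (algebraMap K (AlgebraicClosure K)))))
    (hder : f.derivative ≠ 0)
    (hsep : ∀ (a : K) (b : AlgebraicClosure K), aeval b (f.map (evalRingHom a)) = 0 →
      IsSeparable K b) :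
    ∃ (a : I → K) (b : I → SeparableClosure K),
      (∀ i, aeval (b i) (f.map (evalRingHom (a i))) = 0) ∧
      ∀ S : Finset I, (⨅ i ∈ S, MulAction.stabilizer (SeparableClosure K ≃ₐ[K] SeparableClosure K)
        (b i)).relIndex N = f.natDegree ^ S.card := by
  classical
  obtain ⟨T, b, hTH, hTcard, hb, hdisj⟩ := hK f hirr hder
  have hT (t : T) : ∃ c : SeparableClosure K, (c : AlgebraicClosure K) = b t :=
    ⟨⟨b t, mem_separableClosure_iff.mpr (hsep t _ (hb t))⟩, rfl⟩
  choose c hc using hT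
  let U (t : T) := MulAction.stabilizer (SeparableClosure K ≃ₐ[K] SeparableClosure K) (c t)
  have hdeg (t : T) :
      Module.finrank K (IntermediateField.adjoin K {b t}) = f.natDegree := by
    have hmin := minpoly.eq_of_irreducible_of_monic (hTH t.2) (hb t) (hmonic.map _)
    rw [IntermediateField.adjoin.finrank, ← hmin, hmonic.natDegree_map]
    exact hc t ▸ (mem_separableClosure_iff.mp (c t).2).isIntegral
  have hindex (S : Finset T) : (⨅ i ∈ S, U i).index = f.natDegree ^ S.card := by
    rw [← finrank_biSup_of_linearDisjoint _ hdeg hdisj S]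
    have h1 : (⨅ i ∈ S, U i) = (⨆ i ∈ S, IntermediateField.adjoin K {c i}).fixingSubgroup := by
      induction S using Finset.induction_on with
      | empty => simp
      | insert i S hi ih =>
        rw [Finset.iSup_insert, Finset.iInf_insert, IntermediateField.fixingSubgroup_sup, ih,
          fixingSubgroup_adjoin_simple]
    have h2 : (⨆ i ∈ S, IntermediateField.adjoin K {b i}) =
        (⨆ i ∈ S, IntermediateField.adjoin K {c i}).map (separableClosure K _).val := by
      simp only [IntermediateField.map_iSup, IntermediateField.adjoin_map, Set.image_singleton]
      simp [hc]
    rw [h1, ← IntermediateField.finrank_eq_fixingSubgroup_index, h2]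
    exact (IntermediateField.equivMap _ _).toLinearEquiv.finrank_eq
  have hpos : 0 < f.natDegree := by
    rw [Nat.pos_iff_ne_zero]
    intro h0
    exact hder (by rw [eq_C_of_natDegree_eq_zero h0, derivative_C])
  obtain ⟨S₀, hS₀⟩ := exists_finset_relIndex_eq N U hpos hindex
  have hinf : Infinite T := by
    rw [← Cardinal.aleph0_le_mk_iff, hTcard]; exact Cardinal.aleph0_le_mk K
  obtain ⟨e⟩ : Nonempty (I ≃ (↑((S₀ : Set T)ᶜ) : Type)) := by
    rw [← Cardinal.eq, hI, ← hTcard, Cardinal.mk_compl_of_infinite]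
    exact (Cardinal.lt_aleph0_of_finite _).trans_le (Cardinal.aleph0_le_mk T)
  refine ⟨fun i ↦ (e i).1, fun i ↦ c (e i).1, fun i ↦ ?_, fun S ↦ ?_⟩
  · apply (algebraMap (SeparableClosure K) (AlgebraicClosure K)).injective
    rw [map_zero, ← aeval_algebraMap_apply]
    change aeval (c (e i).1 : AlgebraicClosure K) _ = 0
    rw [hc]
    exact hb (e i).1
  · let j : I ↪ T := e.toEmbedding.trans (Function.Embedding.subtype _)
    rw [← Finset.card_map j, ← hS₀]
    · congr 1
      ext τ
      simp [Subgroup.mem_iInf, j, U]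
    · rw [Finset.disjoint_right]
      intro t ht
      obtain ⟨i, -, rfl⟩ := Finset.mem_map.mp ht
      exact (e i).2

theorem IsFullyHilbertian.infinite {K : Type} [Field K] (hK : IsFullyHilbertian K) :
    Infinite K := by
  by_contra hfin
  rw [not_infinite_iff_finite] at hfin
  let f : K[X][X] := X ^ 2 + (C X * X + C X)
  have hlin {k : Type} [Field k] : (C X * X + C X : k[X][X]).degree < ((2 : ℕ) : WithBot ℕ) := by
    refine (degree_add_le _ _).trans_lt (max_lt ?_ ?_)
    · exact (degree_C_mul_X_le _).trans_lt (by decide)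
    · exact degree_C_le.trans_lt (by decide)
  have hmonic {k : Type} [Field k] : (X ^ 2 + (C X * X + C X) : k[X][X]).Monic :=
    monic_X_pow_add hlin
  have hdeg {k : Type} [Field k] : (X ^ 2 + (C X * X + C X) : k[X][X]).natDegree = 2 := by
    rw [natDegree_add_eq_left_of_degree_lt (by rw [degree_X_pow]; exact hlin), natDegree_X_pow]
  have hirr : Irreducible (f.map (mapRingHom (algebraMap K (AlgebraicClosure K)))) := by
    have hmap : f.map (mapRingHom (algebraMap K (AlgebraicClosure K))) =
        X ^ 2 + (C X * X + C X) := by simp [f]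
    rw [hmap]
    have hE : (X ^ 2 + (C X * X + C X) : (AlgebraicClosure K)[X][X]).IsEisensteinAt
        (Ideal.span {X}) := by
      constructor
      · rw [hmonic.leadingCoeff, ← Ideal.eq_top_iff_one]
        exact (Ideal.span_singleton_eq_top (x := (X : (AlgebraicClosure K)[X]))).not.mpr
          not_isUnit_X
      · intro n hn
        rw [hdeg] at hn
        interval_cases n <;> simp [coeff_X, coeff_X_pow]
      · simp [Ideal.span_singleton_pow, Ideal.mem_span_singleton, coeff_X_pow]
        rw [X_pow_dvd_iff]
        intro h
        simpa using h 1 one_lt_two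
    exact hE.irreducible ((Ideal.span_singleton_prime X_ne_zero).mpr prime_X) hmonic.isPrimitive
      (by rw [hdeg]; decide)
  have hder : f.derivative ≠ 0 := by
    intro h
    have := congrArg (fun g ↦ coeff g 0) h
    simp [f, coeff_X] at this
  obtain ⟨A, b, hA, hcard, -⟩ := hK f hirr hder
  have h0 : (0 : K) ∈ A := by
    have : A = Set.univ := by
      rw [Set.eq_univ_iff_ncard]
      exact congrArg Cardinal.toNat hcard
    exact this ▸ Set.mem_univ _
  have h := hA h0
  simp only [HilbertSet, Set.mem_ofPred_eq, f, Polynomial.map_add, Polynomial.map_pow, map_X,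
    Polynomial.map_mul, map_C, coe_evalRingHom, eval_X, C_0, zero_mul, add_zero] at h
  exact not_irreducible_pow (by decide) h

namespace WittVector

variable {p : ℕ} [hp : Fact p.Prime] {E : Type*} [Field E]

theorem verschiebung_mem_ker_truncate_succ {r : ℕ} {x : WittVector p E} :
    verschiebung x ∈ RingHom.ker (truncate (p := p) (R := E) (r + 1)) ↔
      x ∈ RingHom.ker (truncate (p := p) (R := E) r) := by
  rw [mem_ker_truncate, mem_ker_truncate]
  constructor
  · intro h i hi
    rw [← verschiebung_coeff_succ]
    exact h (i + 1) (Nat.succ_lt_succ hi)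
  · intro h i hi
    cases i with
    | zero => exact verschiebung_coeff_zero _
    | succ i => rw [verschiebung_coeff_succ]; exact h i (Nat.lt_of_succ_lt_succ hi)

theorem mem_ker_truncate_zero (x : WittVector p E) :
    x ∈ RingHom.ker (truncate (p := p) (R := E) 0) :=
  (mem_ker_truncate _ _).mpr fun i hi ↦ absurd hi (Nat.not_lt_zero i)

theorem sub_coeff_zero (x y : WittVector p E) : (x - y).coeff 0 = x.coeff 0 - y.coeff 0 :=
  map_sub (constantCoeff : WittVector p E →+* E) x y

theorem add_coeff_zero' (x y : WittVector p E) : (x + y).coeff 0 = x.coeff 0 + y.coeff 0 :=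
  map_add (constantCoeff : WittVector p E →+* E) x y

theorem intCast_coeff_zero (m : ℤ) : (m : WittVector p E).coeff 0 = m :=
  map_intCast (constantCoeff : WittVector p E →+* E) m

theorem exists_verschiebung_eq_sub {x y : WittVector p E} (h : x.coeff 0 = y.coeff 0) :
    ∃ z, x - y = verschiebung z := by
  have h0 : (x - y).coeff 0 = 0 := by
    rw [sub_coeff_zero, h, sub_self]
  refine ⟨(x - y).shift 1, ?_⟩
  rw [verschiebung_shift]
  · ext; simp [shift_coeff]
  · intro i hi
    obtain rfl : i = 0 := by omega
    exact h0

theorem map_mem_ker_truncate (σ : E →+* E) {r : ℕ} {x : WittVector p E}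
    (hx : x ∈ RingHom.ker (truncate (p := p) (R := E) r)) :
    map σ x ∈ RingHom.ker (truncate (p := p) (R := E) r) := by
  rw [mem_ker_truncate] at hx ⊢
  intro i hi
  rw [map_coeff, hx i hi, map_zero]

variable [CharP E p]

theorem frobenius_verschiebung_comm (x : WittVector p E) :
    frobenius (verschiebung x) = verschiebung (frobenius x) := by
  rw [frobenius_verschiebung, verschiebung_frobenius]

theorem exists_frobenius_sub_mem [IsSepClosed E] (r : ℕ) (w : WittVector p E) (y : E)
    (hy : y ^ p - y = w.coeff 0) :
    ∃ Y : WittVector p E, Y.coeff 0 = y ∧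
      frobenius Y - Y - w ∈ RingHom.ker (truncate (p := p) (R := E) r) := by
  induction r generalizing w y with
  | zero => exact ⟨teichmuller p y, teichmuller_coeff_zero .., mem_ker_truncate_zero _⟩
  | succ r ih =>
    have h0 : w.coeff 0 = (frobenius (teichmuller p y) - teichmuller p y).coeff 0 := by
      rw [sub_coeff_zero, coeff_frobenius_charP, teichmuller_coeff_zero, hy]
    obtain ⟨w', hw'⟩ := exists_verschiebung_eq_sub h0
    obtain ⟨y', hy'⟩ := IsSepClosed.exists_root_C_mul_X_pow_add_C_mul_X_add_C' p p 1 (-1)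
      (-w'.coeff 0) dvd_rfl hp.out.two_le (by simp : (-1 : E) ≠ 0)
    obtain ⟨Y', -, hY'⟩ := ih w' y' (by linear_combination hy')
    refine ⟨teichmuller p y + verschiebung Y', ?_, ?_⟩
    · rw [add_coeff_zero', verschiebung_coeff_zero, teichmuller_coeff_zero, add_zero]
    · have : frobenius (teichmuller p y + verschiebung Y') - (teichmuller p y + verschiebung Y') - w
          = verschiebung (frobenius Y' - Y' - w') := by
        rw [map_sub, map_sub, ← hw', map_add, frobenius_verschiebung_comm]
        ring
      rw [this, verschiebung_mem_ker_truncate_succ]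
      exact hY'

theorem exists_sub_intCast_mem (r : ℕ) (D : WittVector p E)
    (hD : frobenius D - D ∈ RingHom.ker (truncate (p := p) (R := E) r)) :
    ∃ m : ℤ, D - (m : WittVector p E) ∈ RingHom.ker (truncate (p := p) (R := E) r) := by
  induction r generalizing D with
  | zero => exact ⟨0, mem_ker_truncate_zero _⟩
  | succ r ih =>
    have h0 : (D.coeff 0) ^ p = D.coeff 0 := by
      have : (frobenius D - D).coeff 0 = 0 := (mem_ker_truncate _ _).mp hD 0 (Nat.succ_pos r)
      rwa [sub_coeff_zero, sub_eq_zero, coeff_frobenius_charP] at this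
    obtain ⟨k, hk⟩ : ∃ k : ℤ, (k : E) = D.coeff 0 := by
      have := (Subfield.mem_bot_iff_pow_eq_self E p).mpr h0
      rw [← ZMod.fieldRange_castHom_eq_bot p] at this
      obtain ⟨x, hx⟩ := this
      obtain ⟨k, rfl⟩ := ZMod.intCast_surjective x
      exact ⟨k, by rw [← hx, map_intCast]⟩
    have hk0 : D.coeff 0 = ((k : ℤ) : WittVector p E).coeff 0 := by
      rw [intCast_coeff_zero, hk]
    obtain ⟨D', hD'⟩ := exists_verschiebung_eq_sub hk0
    have h1 : frobenius D - D = verschiebung (frobenius D' - D') := by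
      rw [map_sub, ← frobenius_verschiebung_comm, ← hD', map_sub, map_intCast]
      ring
    rw [h1, verschiebung_mem_ker_truncate_succ] at hD
    obtain ⟨m, hm⟩ := ih D' hD
    refine ⟨k + m * p, ?_⟩
    have h2 : D - ((k + m * p : ℤ) : WittVector p E) =
        verschiebung (D' - (m : WittVector p E)) := by
      have := verschiebung_frobenius (p := p) (m : WittVector p E)
      rw [map_intCast] at this
      rw [map_sub, ← hD', this]
      push_cast
      ring
    rw [h2, verschiebung_mem_ker_truncate_succ]
    exact hm

theorem intCast_mem_ker_truncate (r : ℕ) (m : ℤ) :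
    (m : WittVector p E) ∈ RingHom.ker (truncate (p := p) (R := E) r) ↔ ((p ^ r : ℕ) : ℤ) ∣ m := by
  induction r generalizing m with
  | zero => exact iff_of_true (mem_ker_truncate_zero _) (by simp)
  | succ r ih =>
    have hV (k : ℤ) : ((p * k : ℤ) : WittVector p E) = verschiebung (k : WittVector p E) := by
      have := verschiebung_frobenius (p := p) (k : WittVector p E)
      rw [map_intCast] at this
      rw [this]
      push_cast
      ring
    have hmul (k : ℤ) : ((p ^ (r + 1) : ℕ) : ℤ) ∣ p * k ↔ ((p ^ r : ℕ) : ℤ) ∣ k := by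
      rw [pow_succ', Nat.cast_mul,
        mul_dvd_mul_iff_left (Nat.cast_ne_zero.mpr hp.out.ne_zero)]
    constructor
    · intro h
      have h0 : (m : WittVector p E).coeff 0 = 0 :=
        (mem_ker_truncate _ _).mp h 0 (Nat.succ_pos r)
      rw [intCast_coeff_zero, CharP.intCast_eq_zero_iff E p] at h0
      obtain ⟨k, rfl⟩ := h0
      rw [hV, verschiebung_mem_ker_truncate_succ, ih] at h
      exact (hmul k).mpr h
    · intro h
      have hp' : (p : ℤ) ∣ (p ^ (r + 1) : ℕ) := by
        rw [pow_succ', Nat.cast_mul]; exact dvd_mul_right _ _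
      obtain ⟨k, rfl⟩ := hp'.trans h
      rw [hV, verschiebung_mem_ker_truncate_succ, ih]
      exact (hmul k).mp h

theorem map_frobenius_comm (σ : E →+* E) (x : WittVector p E) :
    map σ (frobenius x) = frobenius (map σ x) := by
  ext i
  simp [coeff_frobenius_charP, map_coeff]

/-- Artin–Schreier–Witt theory: an Artin–Schreier character lifts to a character with values
in `ZMod (p ^ r)`. -/
theorem exists_character [IsSepClosed E] {K : Type*} [Field K] [Algebra K E]
    {r : ℕ} (hr : r ≠ 0) (N : Subgroup (E ≃ₐ[K] E)) (y : E)
    (hy : ∀ τ ∈ N, (τ y - y) ^ p = τ y - y) :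
    ∃ ψ : N →* Multiplicative (ZMod (p ^ r)),
      (∀ τ : N, ZMod.castHom (dvd_refl p) E
        (ZMod.castHom (dvd_pow_self p hr) (ZMod p) (ψ τ).toAdd) = (τ : E ≃ₐ[K] E) y - y) ∧
      ∃ s : Finset E, ∀ τ : N, (∀ x ∈ s, (τ : E ≃ₐ[K] E) x = x) → ψ τ = 1 := by
  classical
  let J := RingHom.ker (truncate (p := p) (R := E) r)
  let w : WittVector p E := teichmuller p (y ^ p - y)
  obtain ⟨Y, hY0, hY⟩ := exists_frobenius_sub_mem r w y (teichmuller_coeff_zero ..).symm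
  let act (τ : E ≃ₐ[K] E) : WittVector p E →+* WittVector p E := map (τ : E →+* E)
  have hw (τ) (hτ : τ ∈ N) : act τ w = w := by
    change map _ (teichmuller p _) = _
    rw [map_teichmuller]
    congr 1
    have := hy τ hτ
    rw [sub_pow_char] at this
    change τ _ = _
    rw [map_sub, map_pow]
    linear_combination this
  have hD (τ : N) : ∃ m : ℤ, act τ Y - Y - (m : WittVector p E) ∈ J := by
    refine exists_sub_intCast_mem r _ ?_
    have : frobenius (act τ Y - Y) - (act τ Y - Y) =
        act τ (frobenius Y - Y - w) - (frobenius Y - Y - w) := by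
      rw [map_sub, map_sub, map_sub, hw τ τ.2, map_frobenius_comm]
      ring
    rw [this]
    exact J.sub_mem (map_mem_ker_truncate _ hY) hY
  choose m hm using hD
  have hmul (σ τ : N) : ((m (σ * τ) : ℤ) : ZMod (p ^ r)) = m σ + m τ := by
    rw [← sub_eq_zero]
    have : ((m (σ * τ) - (m σ + m τ) : ℤ) : WittVector p E) ∈ J := by
      have h1 : act (σ * τ : N) Y = act σ (act τ Y) := by
        ext i
        rfl
      have h2 := map_mem_ker_truncate ((σ : E ≃ₐ[K] E) : E →+* E) (hm τ)
      change act σ _ ∈ J at h2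
      have h3 := J.sub_mem (J.add_mem h2 (hm σ)) (hm (σ * τ))
      convert h3 using 1
      rw [h1, map_sub, map_sub, map_intCast]
      push_cast
      ring
    rw [intCast_mem_ker_truncate, ← ZMod.intCast_zmod_eq_zero_iff_dvd] at this
    exact_mod_cast this
  refine ⟨MonoidHom.mk' (fun τ ↦ Multiplicative.ofAdd ((m τ : ℤ) : ZMod (p ^ r)))
    fun σ τ ↦ by rw [hmul]; rfl, fun τ ↦ ?_, (Finset.range r).image Y.coeff, fun τ hτ ↦ ?_⟩
  · change ZMod.castHom _ E (ZMod.castHom _ (ZMod p) ((m τ : ℤ) : ZMod (p ^ r))) = _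
    rw [map_intCast, map_intCast]
    have := (mem_ker_truncate _ _).mp (hm τ) 0 (Nat.pos_of_ne_zero hr)
    rw [sub_coeff_zero, sub_coeff_zero, intCast_coeff_zero, hY0, sub_eq_zero] at this
    rw [← this, map_coeff, hY0]
    rfl
  · change Multiplicative.ofAdd ((m τ : ℤ) : ZMod (p ^ r)) = 1
    have h1 : act τ Y - Y ∈ J := by
      rw [RingHom.sub_mem_ker_iff]
      ext i
      rw [coeff_truncate, coeff_truncate, map_coeff]
      exact hτ _ (Finset.mem_image_of_mem _ (Finset.mem_range.mpr i.2))
    have h2 := J.sub_mem h1 (hm τ)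
    rw [sub_sub_cancel, intCast_mem_ker_truncate, ← ZMod.intCast_zmod_eq_zero_iff_dvd] at h2
    rw [h2]; rfl

end WittVector

theorem card_quotient_fixingSubgroup {K E : Type*} [Field K] [Field E] [Algebra K E]
    [IsGalois K E] (L : IntermediateField K E) [IsGalois K L] :
    Nat.card ((E ≃ₐ[K] E) ⧸ L.fixingSubgroup) = Nat.card (L ≃ₐ[K] L) := by
  rw [← IntermediateField.restrictNormalHom_ker L]
  exact Nat.card_congr (QuotientGroup.quotientKerEquivOfSurjective _
    (AlgEquiv.restrictNormalHom_surjective E)).toEquiv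

/-- A Galois stable elementary abelian `p`-subgroup of `E`, isomorphic to the regular
representation over the prime field, with its coordinate at `1`. -/
theorem exists_stable_addSubgroup {K E : Type*} [Field K] [Field E] [Algebra K E]
    [IsGalois K E] {p : ℕ} [Fact p.Prime] [CharP E p] (L : IntermediateField K E)
    [FiniteDimensional K L] [IsGalois K L] :
    ∃ (V : AddSubgroup E) (c : E → E),
      Nat.card V = p ^ Nat.card ((E ≃ₐ[K] E) ⧸ L.fixingSubgroup) ∧
      (∀ (σ : E ≃ₐ[K] E), ∀ v ∈ V, σ v ∈ V) ∧
      (∀ v ∈ V, v ∈ L) ∧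
      (∀ v ∈ V, ∀ w ∈ V, c (v + w) = c v + c w) ∧
      (∀ v ∈ V, ∃ m : ℤ, c v = m) ∧
      (∀ v ∈ V, (∀ q : (E ≃ₐ[K] E) ⧸ L.fixingSubgroup, c (q.out⁻¹ v) = 0) → v = 0) := by
  classical
  have : CharP K p := (algebraMap K E).charP (algebraMap K E).injective p
  let B := IsGalois.normalBasis K L
  let Φ : ((L ≃ₐ[K] L) → ZMod p) →+ L :=
    { toFun c := ∑ g, ZMod.castHom (dvd_refl p) K (c g) • B g
      map_zero' := by simp
      map_add' := by
        intro c d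
        simp only [Pi.add_apply, map_add, add_smul, Finset.sum_add_distrib] }
  have hrepr (c) (g) : B.repr (Φ c) g = ZMod.castHom (dvd_refl p) K (c g) := by
    change B.repr (∑ g, _) g = _
    rw [B.repr_sum_self]
  have hinj : Function.Injective Φ := by
    intro c d h
    ext g
    apply (ZMod.castHom (dvd_refl p) K).injective
    rw [← hrepr, ← hrepr, h]
  let coord (x : E) : E := if hx : x ∈ L then algebraMap K E (B.repr ⟨x, hx⟩ 1) else 0
  have hcoord (c) : coord (Φ c) = ZMod.castHom (dvd_refl p) E (c 1) := by
    simp only [coord, SetLike.coe_mem, dif_pos]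
    rw [hrepr]
    obtain ⟨m, hm⟩ := ZMod.intCast_surjective (c 1)
    simp only [← hm, map_intCast]
  have hact (σ : E ≃ₐ[K] E) (c) : σ (Φ c) =
      Φ fun g ↦ c ((AlgEquiv.restrictNormalHom L σ)⁻¹ * g) := by
    have : (AlgEquiv.restrictNormalHom L σ) (Φ c) =
        Φ fun g ↦ c ((AlgEquiv.restrictNormalHom L σ)⁻¹ * g) := by
      change AlgEquiv.restrictNormalHom L σ (∑ g, _) = ∑ g, _
      rw [map_sum]
      refine Eq.trans ?_ (Equiv.sum_comp (Equiv.mulLeft (AlgEquiv.restrictNormalHom L σ)) _)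
      refine Finset.sum_congr rfl fun g _ ↦ ?_
      simp only [Equiv.coe_mulLeft, inv_mul_cancel_left, map_smul]
      congr 1
      rw [IsGalois.normalBasis_apply g, IsGalois.normalBasis_apply (_ * _)]
      rfl
    rw [← this]
    exact (AlgEquiv.restrictNormalHom_apply L σ _).symm
  let V := Φ.range.map (L.val : L →+ E)
  have hV {v : E} : v ∈ V ↔ ∃ c, ((Φ c : L) : E) = v := by
    simp [V]
  refine ⟨V, coord, ?_, ?_, ?_, ?_, ?_, ?_⟩
  · rw [card_quotient_fixingSubgroup]
    have : Nat.card V = Nat.card ((L ≃ₐ[K] L) → ZMod p) := by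
      have hinj' : Function.Injective fun c ↦ ((Φ c : L) : E) :=
        Subtype.val_injective.comp hinj
      have hrange : (V : Set E) = Set.range fun c ↦ ((Φ c : L) : E) := by
        ext v
        exact hV
      rw [← SetLike.coe_sort_coe, hrange]
      exact Nat.card_congr (Equiv.ofInjective _ hinj').symm
    rw [this, Nat.card_fun]
    simp
  · intro σ v hv
    obtain ⟨c, rfl⟩ := hV.mp hv
    exact hV.mpr ⟨_, (hact σ c).symm⟩
  · intro v hv
    obtain ⟨c, rfl⟩ := hV.mp hv
    exact (Φ c).2
  · intro v hv w hw
    obtain ⟨c, rfl⟩ := hV.mp hv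
    obtain ⟨d, rfl⟩ := hV.mp hw
    have : ((Φ c : L) : E) + (Φ d : L) = (Φ (c + d) : L) := by rw [map_add]; rfl
    rw [this, hcoord, hcoord, hcoord, Pi.add_apply, map_add]
  · intro v hv
    obtain ⟨c, rfl⟩ := hV.mp hv
    obtain ⟨m, hm⟩ := ZMod.intCast_surjective (c 1)
    exact ⟨m, by rw [hcoord, ← hm, map_intCast]⟩
  · intro v hv h
    obtain ⟨c, rfl⟩ := hV.mp hv
    have hc : c = 0 := by
      ext g
      obtain ⟨σ, rfl⟩ := AlgEquiv.restrictNormalHom_surjective (F := K) (K₁ := L) E g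
      have hσ := h (σ : (E ≃ₐ[K] E) ⧸ L.fixingSubgroup)
      rw [hact, hcoord, map_inv, inv_inv, mul_one, map_eq_zero] at hσ
      rw [Pi.zero_apply, ← hσ]
      congr 1
      have := QuotientGroup.eq.mp (QuotientGroup.out_eq' (σ : (E ≃ₐ[K] E) ⧸ L.fixingSubgroup)).symm
      have := (SetLike.ext_iff.mp (IntermediateField.restrictNormalHom_ker L) _).mpr this
      rwa [MonoidHom.mem_ker, map_mul, map_inv, inv_mul_eq_one] at this
    rw [hc, map_zero]
    rfl

theorem prod_X_sub_C_sub_C_eval {F V : Type*} [Field F] [AddCommGroup V] [Fintype V]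
    (u : V →+ F) (hu : Function.Injective u) (b : F) :
    ∏ v, (X - C (u v)) - C ((∏ v, (X - C (u v))).eval b) = ∏ v, (X - C (b + u v)) := by
  have hinj : Function.Injective fun v ↦ b + u v := (add_right_injective b).comp hu
  refine eq_of_degree_sub_lt_of_eval_index_eq Finset.univ hinj.injOn ?_ fun v _ ↦ ?_
  · have h₁ : (∏ v, (X - C (u v))).degree = (Fintype.card V : WithBot ℕ) := by simp [degree_prod]
    have h₂ : (∏ v, (X - C (b + u v))).degree = (Fintype.card V : WithBot ℕ) := by
      simp only [degree_prod, degree_X_sub_C, Finset.sum_const, Finset.card_univ, nsmul_one]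
    have h₀ : (0 : WithBot ℕ) < Fintype.card V := by exact_mod_cast Fintype.card_pos
    have h₃ : (∏ v, (X - C (u v)) - ∏ v, (X - C (b + u v))).degree <
        (Fintype.card V : WithBot ℕ) := by
      rw [← h₁]
      refine degree_sub_lt_left (h₁.trans h₂.symm) (monic_prod_X_sub_C _ _).ne_zero ?_
      rw [(monic_prod_X_sub_C _ _).leadingCoeff, (monic_prod_X_sub_C _ _).leadingCoeff]
    rw [sub_right_comm, Finset.card_univ]
    exact (degree_sub_le _ _).trans_lt (max_lt h₃ (degree_C_le.trans_lt h₀))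
  · have h₁ : (∏ w, (X - C (b + u w))).eval (b + u v) = 0 := by
      rw [eval_prod]
      exact Finset.prod_eq_zero (Finset.mem_univ v) (by simp)
    rw [h₁, eval_sub, eval_C, sub_eq_zero, eval_prod, eval_prod,
      ← Equiv.prod_comp (Equiv.addRight v)]
    refine Finset.prod_congr rfl fun w _ ↦ ?_
    simp

theorem exists_monic_map_eq_prod {K E : Type*} [Field K] [Field E] [Algebra K E] [IsGalois K E]
    (V : AddSubgroup E) [Fintype V] (hV : ∀ (σ : E ≃ₐ[K] E), ∀ v ∈ V, σ v ∈ V) :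
    ∃ P : K[X], P.Monic ∧ P.map (algebraMap K E) = ∏ v : V, (X - C (v : E)) := by
  have hmem : ∏ v : V, (X - C (v : E)) ∈ lifts (algebraMap K E) := by
    rw [lifts_iff_coeff_lifts]
    intro n
    rw [InfiniteGalois.mem_range_algebraMap_iff_fixed]
    intro σ
    have : (∏ v : V, (X - C (v : E))).map (σ : E →+* E) = ∏ v : V, (X - C (v : E)) := by
      simp only [Polynomial.map_prod, Polynomial.map_sub, map_X, map_C]
      refine Fintype.prod_bijective (fun v : V ↦ (⟨σ v, hV σ v v.2⟩ : V)) ⟨?_, ?_⟩ _ _ fun _ ↦ rfl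
      · intro v w h
        exact Subtype.ext (σ.injective (Subtype.ext_iff.mp h))
      · intro v
        exact ⟨⟨σ.symm v, hV σ.symm v v.2⟩, Subtype.ext (σ.apply_symm_apply v)⟩
    conv_rhs => rw [← this]
    rw [coeff_map]
    rfl
  obtain ⟨P, h, -, hP⟩ := lifts_and_natDegree_eq_and_monic hmem (monic_prod_X_sub_C _ _)
  exact ⟨P, hP, h⟩

theorem irreducible_map_C_sub_C_X {F : Type*} [Field F] (P : F[X]) :
    Irreducible (P.map C - C X : F[X][X]) := by
  rw [← MulEquiv.irreducible_iff (Bivariate.swap (R := F)), map_sub, Bivariate.swap_map_C,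
    Bivariate.swap_X, ← neg_sub]
  exact (Associated.refl (X - C P)).neg_left.symm.irreducible (prime_X_sub_C P).irreducible

theorem IsFullyHilbertian.exists_conjIndependent_of_charP {K : Type} [Field K] [Infinite K]
    (hK : IsFullyHilbertian K) (p : ℕ) [Fact p.Prime] [CharP K p] {r : ℕ} (hr : r ≠ 0)
    (L : IntermediateField K (SeparableClosure K)) [FiniteDimensional K L] [IsGalois K L]
    [L.fixingSubgroup.FiniteIndex] [L.fixingSubgroup.Normal]
    {I : Type} (hI : Cardinal.mk I = Cardinal.mk K) :
    ∃ ψ : I → L.fixingSubgroup →* Multiplicative (ZMod (p ^ r)),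
      ConjIndependent L.fixingSubgroup ψ ∧
      ∀ i, ∃ s : Finset (SeparableClosure K), ∀ τ : L.fixingSubgroup,
        (∀ x ∈ s, (τ : SeparableClosure K ≃ₐ[K] SeparableClosure K) x = x) → ψ i τ = 1 := by
  classical
  have : CharP (SeparableClosure K) p :=
    charP_of_injective_algebraMap (algebraMap K (SeparableClosure K)).injective p
  obtain ⟨V, c, hcard, hstab, hVL, hadd, h_int, hzero⟩ := exists_stable_addSubgroup (p := p) L
  have hp : p.Prime := Fact.out
  have : Finite V := Nat.finite_of_card_ne_zero (hcard ▸ pow_ne_zero _ hp.ne_zero)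
  have := Fintype.ofFinite V
  obtain ⟨P, hP, hPV⟩ := exists_monic_map_eq_prod V hstab
  have hdeg : P.natDegree = Nat.card V := by
    rw [← natDegree_map (algebraMap K (SeparableClosure K)), hPV,
      natDegree_prod_of_monic _ _ fun v _ ↦ monic_X_sub_C _]
    simp
  have hroot (F : Type) [Field F] [Algebra K F] (ι : SeparableClosure K →ₐ[K] F) (a : K) (b : F)
      (hb : aeval b (P - C a) = 0) :
      (P - C a).map (algebraMap K F) = ∏ v : V, (X - C (b + ι v)) := by
    have hPF : P.map (algebraMap K F) = ∏ v : V, (X - C (ι v)) := by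
      rw [← ι.comp_algebraMap, ← Polynomial.map_map, hPV, Polynomial.map_prod]
      simp
    have key : ∏ v : V, (X - C (ι v)) - C ((∏ v : V, (X - C (ι v))).eval b) =
        ∏ v : V, (X - C (b + ι v)) :=
      prod_X_sub_C_sub_C_eval (ι.toRingHom.toAddMonoidHom.comp V.subtype)
        (ι.injective.comp V.subtype_injective) b
    rw [← key, Polynomial.map_sub, hPF, map_C]
    congr 2
    rw [← sub_eq_zero, ← neg_eq_zero, neg_sub, ← hb, aeval_def, ← eval_map, Polynomial.map_sub,
      hPF, eval_sub, map_C, eval_C]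
  have hsep (a : K) : (P - C a).Separable := by
    have hd : (P - C a).degree ≠ 0 := by
      intro h
      have := natDegree_eq_of_degree_eq_some h
      rw [natDegree_sub_C, hdeg] at this
      exact Nat.card_pos.ne' this
    obtain ⟨b, hb⟩ := IsAlgClosed.exists_aeval_eq_zero (AlgebraicClosure K) (P - C a) hd
    rw [← separable_map (algebraMap K (AlgebraicClosure K)),
      hroot _ (IsScalarTower.toAlgHom K (SeparableClosure K) (AlgebraicClosure K)) a b hb,
      separable_prod_X_sub_C_iff]
    exact (add_right_injective b).comp ((RingHom.injective _).comp Subtype.val_injective)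
  let f : K[X][X] := P.map C - C X
  have hmap (a : K) : f.map (evalRingHom a) = P - C a := by
    have : (evalRingHom a).comp C = RingHom.id K := by
      ext
      simp
    simp [f, Polynomial.map_map, this]
  have hposV : 0 < P.natDegree := hdeg ▸ Nat.card_pos
  have hfm : f.Monic := by
    refine (hP.map C).sub_of_left (degree_C_le.trans_lt ?_)
    rw [degree_map_eq_of_injective C_injective]
    exact natDegree_pos_iff_degree_pos.mp hposV
  have hfd : f.natDegree = Nat.card V := by
    rw [natDegree_sub_C, natDegree_map_eq_of_injective C_injective, hdeg]
  have hirr : Irreducible (f.map (mapRingHom (algebraMap K (AlgebraicClosure K)))) := by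
    convert irreducible_map_C_sub_C_X (P.map (algebraMap K (AlgebraicClosure K))) using 1
    simp only [f, Polynomial.map_sub, Polynomial.map_map, map_C, coe_mapRingHom, map_X]
    congr 2
    ext
    simp
  have hder : f.derivative ≠ 0 := by
    intro h
    have h₀ := hsep 0
    rw [← hmap, Polynomial.Separable, derivative_map, h, Polynomial.map_zero,
      isCoprime_zero_right, hmap] at h₀
    have := natDegree_eq_zero_of_isUnit h₀
    rw [natDegree_sub_C] at this
    exact hposV.ne' this
  obtain ⟨a, b, hab, hrel⟩ := hK.exists_relIndex_eq L.fixingSubgroup hI f hfm hirr hder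
    fun a b hb ↦ (hsep a).of_dvd (minpoly.dvd K b (hmap a ▸ hb))
  have hmove (i : I) (σ : SeparableClosure K ≃ₐ[K] SeparableClosure K) :
      σ (b i) - b i ∈ V := by
    have h₁ := hroot _ (AlgHom.id K _) (a i) (b i) (hmap (a i) ▸ hab i)
    have h₂ : aeval (σ (b i)) (P - C (a i)) = 0 := by
      rw [aeval_algHom_apply, ← hmap, hab, map_zero]
    rw [aeval_def, ← eval_map, h₁, eval_prod, Finset.prod_eq_zero_iff] at h₂
    obtain ⟨v, -, hv⟩ := h₂
    rw [eval_sub, eval_X, eval_C, sub_eq_zero] at hv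
    rw [hv]
    simp
  let R : (SeparableClosure K)[X] :=
    Lagrange.interpolate Finset.univ (fun v : V ↦ (v : SeparableClosure K)) fun v ↦ c v
  have hinj : Set.InjOn (fun v : V ↦ (v : SeparableClosure K)) (Finset.univ : Finset V) :=
    Subtype.val_injective.injOn
  have hR (v : V) : R.eval (v : SeparableClosure K) = c v :=
    Lagrange.eval_interpolate_at_node _ hinj (Finset.mem_univ v)
  have hRdeg : R.degree < (Finset.univ : Finset V).card := Lagrange.degree_interpolate_lt _ hinj
  have hRadd (x : SeparableClosure K) (v : V) : R.eval (x + v) = R.eval x + c v := by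
    have : R.comp (X + C (v : SeparableClosure K)) = R + C (c v) := by
      refine eq_of_degrees_lt_of_eval_index_eq Finset.univ hinj ?_ ?_ fun w _ ↦ ?_
      · rwa [← taylor_apply, degree_taylor]
      · refine (degree_add_le _ _).trans_lt (max_lt hRdeg (degree_C_le.trans_lt ?_))
        exact_mod_cast Finset.univ_nonempty.card_pos
      · rw [eval_comp, eval_add, eval_add, eval_X, eval_C, eval_C, hR, ← hadd _ w.2 _ v.2]
        exact hR (w + v)
    have := congrArg (eval x) this
    rwa [eval_comp, eval_add, eval_add, eval_X, eval_C, eval_C] at this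
  have hfix (τ : L.fixingSubgroup) {v} (hv : v ∈ V) :
      (τ : SeparableClosure K ≃ₐ[K] SeparableClosure K) v = v := τ.2 ⟨v, hVL v hv⟩
  have hRτ (τ : L.fixingSubgroup) (x : SeparableClosure K) :
      (τ : SeparableClosure K ≃ₐ[K] SeparableClosure K) (R.eval x) =
        R.eval ((τ : SeparableClosure K ≃ₐ[K] SeparableClosure K) x) := by
    have : R.map (τ : SeparableClosure K ≃ₐ[K] SeparableClosure K).toRingHom = R := by
      refine eq_of_degrees_lt_of_eval_index_eq Finset.univ hinj ?_ hRdeg fun v _ ↦ ?_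
      · exact degree_map_le.trans_lt hRdeg
      · obtain ⟨m, hm⟩ := h_int v v.2
        conv_lhs => rw [← hfix τ v.2]
        refine (eval_map_apply (τ : SeparableClosure K ≃ₐ[K]
          SeparableClosure K).toRingEquiv.toRingHom _).trans ?_
        rw [hR, hm, map_intCast]
    conv_rhs => rw [← this]
    exact (eval_map_apply (τ : SeparableClosure K ≃ₐ[K]
      SeparableClosure K).toRingEquiv.toRingHom x).symm
  have hy (i : I) (τ : L.fixingSubgroup) :
      (τ : SeparableClosure K ≃ₐ[K] SeparableClosure K) (R.eval (b i)) - R.eval (b i) =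
        c ((τ : SeparableClosure K ≃ₐ[K] SeparableClosure K) (b i) - b i) := by
    have := hRadd (b i) ⟨_, hmove i τ⟩
    rw [hRτ, ← add_sub_cancel (b i) ((τ : SeparableClosure K ≃ₐ[K] SeparableClosure K) (b i)),
      this]
    simp
  choose ψ hψ hker using fun i ↦ WittVector.exists_character hr L.fixingSubgroup (R.eval (b i)) (by
    intro τ hτ
    obtain ⟨m, hm⟩ := h_int _ (hmove i τ)
    rw [hy i ⟨τ, hτ⟩, hm]
    exact map_intCast (frobenius (SeparableClosure K) p) m)
  refine ⟨ψ, ?_, hker⟩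
  have hdvd := dvd_pow_self p hr
  let ψ₁ (i : I) : L.fixingSubgroup →* Multiplicative (ZMod p) :=
    (AddMonoidHom.toMultiplicative (ZMod.castHom hdvd (ZMod p)).toAddMonoidHom).comp (ψ i)
  refine ConjIndependent.of_castHom Fact.out hdvd ψ ψ₁ ?_ fun _ _ ↦ rfl
  refine conjIndependent_of_relIndex ψ₁ (fun i ↦ MulAction.stabilizer _ (b i)) ?_ ?_
  · intro S
    rw [hrel, hfd, hcard]
    simp
  · intro i τ hτ
    rw [MulAction.mem_stabilizer_iff, AlgEquiv.smul_def, ← sub_eq_zero]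
    refine hzero _ (hmove i τ) fun q ↦ ?_
    have h₁ : ZMod.castHom hdvd (ZMod p) (ψ i (MulAut.conjNormal q.out⁻¹ τ)).toAdd = 0 :=
      congrArg Multiplicative.toAdd (hτ q)
    have h₂ := hψ i (MulAut.conjNormal q.out⁻¹ τ)
    rw [h₁, map_zero, hy] at h₂
    rw [h₂]
    congr 1
    have h₃ := hfix τ (hmove i q.out)
    rw [map_sub] at h₃
    rw [MulAut.conjNormal_apply, inv_inv, AlgEquiv.mul_apply, AlgEquiv.mul_apply, map_sub]
    rw [sub_eq_iff_eq_add] at h₃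
    have h₄ : q.out⁻¹ (q.out (b i)) = b i := AlgEquiv.symm_apply_apply q.out (b i)
    rw [h₃, map_add, map_sub, h₄]
    ring

namespace MvPolynomial

theorem coeff_aeval_C_mul_X {Q k : Type*} [Fintype Q] [CommSemiring k] (η : Q → k)
    (p : MvPolynomial Q k) (m : Q →₀ ℕ) :
    coeff m (aeval (fun q ↦ C (η q) * X q) p) = (∏ q, η q ^ m q) * coeff m p := by
  classical
  induction p using MvPolynomial.induction_on' with
  | monomial u a =>
    have : aeval (fun q ↦ C (η q) * X q) (monomial u a) =
        C (∏ q, η q ^ u q) * monomial u a := by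
      rw [aeval_monomial, Finsupp.prod_fintype _ _ (by simp), monomial_eq,
        Finsupp.prod_fintype _ _ (by simp), map_prod]
      simp only [mul_pow, Finset.prod_mul_distrib, algebraMap_eq, map_pow]
      ring
    rw [this, coeff_C_mul, coeff_monomial]
    split_ifs with h
    · rw [h]
    · simp
  | add p q hp hq => rw [map_add, coeff_add, hp, hq, coeff_add, mul_add]

theorem exists_expand_eq {Q k : Type*} [Fintype Q] [CommRing k] [IsDomain k] {n : ℕ} [NeZero n]
    {ζ : k} (hζ : IsPrimitiveRoot ζ n) (p : MvPolynomial Q k)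
    (h : ∀ η : Q → k, (∀ q, η q ^ n = 1) → aeval (fun q ↦ C (η q) * X q) p = p) :
    ∃ r, expand n r = p := by
  classical
  have hdvd (m) (hm : m ∈ p.support) (q) : n ∣ m q := by
    rw [← hζ.pow_eq_one_iff_dvd]
    have hη : ∀ q', (Pi.mulSingle q ζ : Q → k) q' ^ n = 1 := by
      intro q'
      obtain rfl | hq := eq_or_ne q' q
      · rw [Pi.mulSingle_eq_same, hζ.pow_eq_one]
      · rw [Pi.mulSingle_eq_of_ne hq, one_pow]
    have h₁ := congrArg (coeff m) (h _ hη)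
    rw [coeff_aeval_C_mul_X, mul_left_eq_self₀, or_iff_left (mem_support_iff.mp hm),
      Finset.prod_eq_single q] at h₁
    · rwa [Pi.mulSingle_eq_same] at h₁
    · intro q' _ hq
      rw [Pi.mulSingle_eq_of_ne hq, one_pow]
    · simp
  refine ⟨∑ m ∈ p.support, monomial (m.mapRange (· / n) (Nat.zero_div n)) (coeff m p), ?_⟩
  conv_rhs => rw [p.as_sum]
  rw [map_sum]
  refine Finset.sum_congr rfl fun m hm ↦ ?_
  rw [expand_monomial]
  congr 2
  ext q
  simp [Nat.mul_div_cancel' (hdvd m hm q)]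

end MvPolynomial

noncomputable instance rootsOfUnity.instFintype {R : Type*} [CommRing R] [IsDomain R] (n : ℕ)
    [NeZero n] : Fintype (rootsOfUnity n R) :=
  Fintype.ofFinite _

/-- The monic polynomial whose roots are the sums `∑ ε q * y q`, the coefficients `ε q` ranging
over all `n`-th roots of unity. -/
noncomputable def prodRootsOfUnity {Q k T : Type*} [Fintype Q] [DecidableEq Q] [CommRing k]
    [IsDomain k] [CommRing T] (n : ℕ) [NeZero n] (j : k →+* T) (y : Q → T) : T[X] :=
  ∏ ε : Q → rootsOfUnity n k, (X - C (∑ q, j ((ε q : kˣ) : k) * y q))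

section

variable {Q k T : Type*} [Fintype Q] [DecidableEq Q] [CommRing k] [IsDomain k] [CommRing T]
  (n : ℕ) [NeZero n] (j : k →+* T) (y : Q → T)

theorem monic_prodRootsOfUnity : (prodRootsOfUnity n j y).Monic :=
  monic_prod_X_sub_C _ _

theorem map_prodRootsOfUnity {T' : Type*} [CommRing T'] (h : T →+* T') :
    (prodRootsOfUnity n j y).map h = prodRootsOfUnity n (h.comp j) (h ∘ y) := by
  simp [prodRootsOfUnity, Polynomial.map_prod, Polynomial.map_sum]

theorem prodRootsOfUnity_mul (η : Q → k) (hη : ∀ q, η q ^ n = 1) :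
    prodRootsOfUnity n j (fun q ↦ j (η q) * y q) = prodRootsOfUnity n j y := by
  let η' : Q → rootsOfUnity n k := fun q ↦ rootsOfUnity.mkOfPowEq (η q) (hη q)
  refine Fintype.prod_equiv (Equiv.mulRight η') _ _ fun ε ↦ ?_
  congr 2
  refine Finset.sum_congr rfl fun q _ ↦ ?_
  simp [η', mul_assoc]

theorem prodRootsOfUnity_comp (σ : k ≃+* k) (π : Equiv.Perm Q) :
    prodRootsOfUnity n (j.comp (σ : k →+* k)) (y ∘ π) = prodRootsOfUnity n j y := by
  refine Fintype.prod_equiv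
    (Equiv.arrowCongr π (MulEquiv.restrictRootsOfUnity σ.toMulEquiv n).toEquiv) _ _ fun ε ↦ ?_
  congr 2
  refine Fintype.sum_equiv π _ _ fun q ↦ ?_
  simp

end

theorem exists_monic_map_eq_prodRootsOfUnity {K k Q : Type*} [Field K] [Field k] [Algebra K k]
    [IsGalois K k] [Fintype Q] [DecidableEq Q] {n : ℕ} [NeZero n] {ζ : k}
    (hζ : IsPrimitiveRoot ζ n) [MulAction (k ≃ₐ[K] k) Q] (κ : Q → k)
    (hκ : ∀ (σ : k ≃ₐ[K] k) q, κ (σ • q) = σ (κ q)) :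
    ∃ f : K[X][X], f.Monic ∧ ∀ {T : Type} [CommRing T] (j : k[X] →+* T) (y : Q → T),
      (∀ q, y q ^ n = j (X - C (κ q))) →
      f.map (j.comp (mapRingHom (algebraMap K k))) = prodRootsOfUnity n (j.comp C) y := by
  have hlift : prodRootsOfUnity n (MvPolynomial.C (σ := Q) (R := k)) MvPolynomial.X ∈
      lifts (MvPolynomial.expand (σ := Q) (R := k) n).toRingHom := by
    rw [lifts_iff_coeff_lifts]
    intro m
    refine MvPolynomial.exists_expand_eq hζ _ fun η hη ↦ ?_
    have h₁ := map_prodRootsOfUnity n (MvPolynomial.C (σ := Q) (R := k)) MvPolynomial.X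
      (MvPolynomial.aeval (fun q ↦ MvPolynomial.C (η q) * MvPolynomial.X (R := k) q)).toRingHom
    have h₂ := prodRootsOfUnity_mul n (MvPolynomial.C (σ := Q) (R := k)) MvPolynomial.X η hη
    conv_rhs => rw [← h₂]
    convert (congrArg (fun P ↦ coeff P m) h₁) using 1
    · rw [coeff_map]
      rfl
    · congr 2
      · ext; simp
      · ext
        simp
  obtain ⟨g, hg, -, hgm⟩ := lifts_and_natDegree_eq_and_monic hlift (monic_prodRootsOfUnity ..)
  let ev : MvPolynomial Q k →+* k[X] := MvPolynomial.eval₂Hom C fun q ↦ X - C (κ q)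
  have hev {T : Type} [CommRing T] (j : k[X] →+* T) (y : Q → T)
      (hy : ∀ q, y q ^ n = j (X - C (κ q))) :
      (g.map ev).map j = prodRootsOfUnity n (j.comp C) y := by
    have h₁ : j.comp ev = (MvPolynomial.eval₂Hom (j.comp C) y).comp
        (MvPolynomial.expand n).toRingHom := by
      refine MvPolynomial.ringHom_ext ?_ ?_
      · simp [ev]
      · intro q
        simp only [ev, RingHom.comp_apply, MvPolynomial.eval₂Hom_X', ← hy]
        simp
    rw [Polynomial.map_map, h₁, ← Polynomial.map_map, hg, map_prodRootsOfUnity]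
    congr 1
    · ext; simp
    · ext; simp
  have hdesc : g.map ev ∈ lifts (mapRingHom (algebraMap K k)) := by
    rw [lifts_iff_coeff_lifts]
    intro m
    refine (mem_lifts _).mp ((lifts_iff_coeff_lifts _).mpr fun m' ↦ ?_)
    rw [InfiniteGalois.mem_range_algebraMap_iff_fixed]
    intro σ
    let Θ : MvPolynomial Q k →+* MvPolynomial Q k :=
      MvPolynomial.eval₂Hom (MvPolynomial.C.comp (σ : k →+* k)) fun q ↦ MvPolynomial.X (σ • q)
    have h₁ : Θ.comp (MvPolynomial.expand n).toRingHom =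
        (MvPolynomial.expand n).toRingHom.comp Θ := by
      refine MvPolynomial.ringHom_ext ?_ ?_
      · simp [Θ]
      · intro q
        simp [Θ]
    have h₂ : g.map Θ = g := by
      refine Polynomial.map_injective (MvPolynomial.expand n).toRingHom
        (MvPolynomial.expand_injective (NeZero.pos n)) ?_
      rw [Polynomial.map_map, ← h₁, ← Polynomial.map_map, hg, map_prodRootsOfUnity]
      convert prodRootsOfUnity_comp n (MvPolynomial.C (σ := Q) (R := k)) MvPolynomial.X
        σ.toRingEquiv (MulAction.toPerm σ) using 2
      · ext; simp [Θ]
      · ext; simp [Θ]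
    have h₃ : (mapRingHom (σ : k →+* k)).comp ev = ev.comp Θ := by
      refine MvPolynomial.ringHom_ext ?_ ?_
      · simp [Θ, ev]
      · intro q
        simp [Θ, ev, hκ]
    have h₄ : (g.map ev).map (mapRingHom (σ : k →+* k)) = g.map ev := by
      rw [Polynomial.map_map, h₃, ← Polynomial.map_map, h₂]
    conv_rhs => rw [← h₄]
    rw [coeff_map (mapRingHom _), coe_mapRingHom, coeff_map (σ : k →+* k)]
    rfl
  obtain ⟨f, hf, -, hfm⟩ := lifts_and_natDegree_eq_and_monic hdesc (hgm.map ev)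
  refine ⟨f, hfm, fun j y hy ↦ ?_⟩
  rw [← Polynomial.map_map, hf, hev j y hy]

theorem IsPrimitiveRoot.pow_zmodVal_add {M : Type*} [CommMonoid M] {n : ℕ} [NeZero n] {ζ : M}
    (hζ : IsPrimitiveRoot ζ n) (a b : ZMod n) :
    ζ ^ (a + b).val = ζ ^ a.val * ζ ^ b.val := by
  rw [ZMod.val_add, ← pow_add, ← pow_eq_pow_mod _ hζ.pow_eq_one]

/-- The Kummer character attached to `y`. -/
theorem exists_kummerCharacter {K E : Type*} [Field K] [Field E] [Algebra K E]
    (N : Subgroup (E ≃ₐ[K] E)) {n : ℕ} [NeZero n] {ζ : E} (hζ : IsPrimitiveRoot ζ n)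
    (hN : ∀ τ ∈ N, τ ζ = ζ) {y : E} (hy₀ : y ≠ 0) (hy : ∀ τ ∈ N, τ (y ^ n) = y ^ n) :
    ∃ f : N →* Multiplicative (ZMod n), ∀ τ : N,
      (τ : E ≃ₐ[K] E) y = ζ ^ (f τ).toAdd.val * y := by
  have hex (τ : N) : ∃ a : ZMod n, (τ : E ≃ₐ[K] E) y = ζ ^ a.val * y := by
    have : ((τ : E ≃ₐ[K] E) y / y) ^ n = 1 := by
      rw [div_pow, ← map_pow, hy τ τ.2, div_self (pow_ne_zero n hy₀)]
    obtain ⟨i, hi, h⟩ := hζ.eq_pow_of_pow_eq_one this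
    refine ⟨i, ?_⟩
    rw [ZMod.val_natCast_of_lt hi, h, div_mul_cancel₀ _ hy₀]
  choose a ha using hex
  refine ⟨MonoidHom.mk' (fun τ ↦ Multiplicative.ofAdd (a τ)) fun τ υ ↦ ?_, ha⟩
  rw [← ofAdd_add]
  congr 1
  refine ZMod.val_injective n (hζ.pow_inj (ZMod.val_lt _) (ZMod.val_lt _) ?_)
  refine mul_right_cancel₀ hy₀ ?_
  rw [← ha, hζ.pow_zmodVal_add, Subgroup.coe_mul, AlgEquiv.mul_apply, ha υ, map_mul, map_pow,
    hN τ τ.2, ha τ]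
  ring

theorem rootMultiplicity_prod_X_sub_C_pow {k Q : Type*} [Field k] [Fintype Q] {κ : Q → k}
    (hκ : Function.Injective κ) (m : Q → ℕ) (q : Q) :
    rootMultiplicity (κ q) (∏ q, (X - C (κ q)) ^ m q) = m q := by
  classical
  rw [← Finset.prod_erase_mul _ _ (Finset.mem_univ q), rootMultiplicity_mul_X_sub_C_pow,
    rootMultiplicity_eq_zero, zero_add]
  · rw [IsRoot.def, eval_prod, Finset.prod_eq_zero_iff]
    rintro ⟨q', hq', h⟩
    rw [eval_pow, eval_sub, eval_X, eval_C] at h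
    exact (Finset.mem_erase.mp hq').1 (hκ (sub_eq_zero.mp (eq_zero_of_pow_eq_zero h))).symm
  · exact Finset.prod_ne_zero_iff.mpr fun q' _ ↦ pow_ne_zero _ (X_sub_C_ne_zero _)

/-- Distinct linear polynomials are independent modulo `ℓ`-th powers. -/
theorem dvd_of_pow_eq_prod_X_sub_C_pow {k Q : Type*} [Field k] [Fintype Q] {κ : Q → k}
    (hκ : Function.Injective κ) {m : Q → ℕ} {ℓ : ℕ} {P : k[X]}
    (h : P ^ ℓ = ∏ q, (X - C (κ q)) ^ m q) (q : Q) : ℓ ∣ m q := by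
  classical
  rw [← rootMultiplicity_prod_X_sub_C_pow hκ m q, ← h, ← count_roots, roots_pow,
    Multiset.count_nsmul]
  exact dvd_mul_right _ _

theorem exists_algEquiv_kummer {k Q : Type*} [Field k] [Fintype Q] {n : ℕ} [NeZero n]
    {ζ : k} (hζ : IsPrimitiveRoot ζ n) {κ : Q → k} (hκ : Function.Injective κ)
    {F E : Type*} [Field F] [Algebra k[X] F] [IsFractionRing k[X] F] [Field E] [Algebra F E]
    [IsGalois F E] (j : k[X] →+* E) (hj : j = (algebraMap F E).comp (algebraMap k[X] F))
    {y : Q → E} (hy : ∀ q, y q ^ n = j (X - C (κ q))) (a : Q → ZMod n) :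
    ∃ σ : E ≃ₐ[F] E, ∀ q, σ (y q) = j (C ζ) ^ (a q).val * y q := by
  classical
  have hjinj : Function.Injective j := by
    rw [hj, RingHom.coe_comp]
    exact (algebraMap F E).injective.comp (IsFractionRing.injective k[X] F)
  have hjσ (σ : E ≃ₐ[F] E) (P : k[X]) : σ (j P) = j P := by
    rw [hj]
    exact σ.commutes _
  have hζ' : IsPrimitiveRoot (j (C ζ)) n :=
    hζ.map_of_injective (f := j.comp C) (hjinj.comp C_injective)
  have hy₀ (q) : y q ≠ 0 := by
    intro h
    have := hy q
    rw [h, zero_pow (NeZero.ne n), eq_comm, map_eq_zero_iff _ hjinj] at this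
    exact X_sub_C_ne_zero _ this
  choose f hf using fun q ↦ exists_kummerCharacter (⊤ : Subgroup (E ≃ₐ[F] E)) hζ'
    (fun τ _ ↦ hjσ τ _) (hy₀ q) (fun τ _ ↦ by rw [hy, hjσ])
  have hsurj : Function.Surjective (MonoidHom.pi f) := by
    refine exists_eq_of_forall_prime (NeZero.ne n) _ fun ℓ hℓ hdvd x ↦ ?_
    have := Fact.mk hℓ
    let H : AddSubgroup (Q → ZMod ℓ) := AddMonoidHom.range
      (AddMonoidHom.mk' (fun τ q ↦ ZMod.castHom hdvd (ZMod ℓ) (f q τ.toMul).toAdd) fun τ υ ↦ by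
        ext q
        simp only [toMul_add, map_mul, toAdd_mul, map_add, Pi.add_apply] :
          Additive (⊤ : Subgroup (E ≃ₐ[F] E)) →+ (Q → ZMod ℓ))
    have hH : AddSubgroup.toZModSubmodule ℓ H = ⊤ := by
      by_contra hne
      obtain ⟨φ, hφ, hle⟩ := Submodule.exists_le_ker_of_lt_top _ (lt_top_iff_ne_top.mpr hne)
      refine hφ ?_
      let e (q : Q) : ZMod ℓ := φ fun q' ↦ if q = q' then 1 else 0
      have he (v) : φ v = ∑ q, v q * e q := φ.pi_apply_eq_sum_univ v
      let u : E := ∏ q, y q ^ (n / ℓ * (e q).val)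
      have hu (σ : E ≃ₐ[F] E) : σ u = u := by
        have hσ : ∑ q, ZMod.castHom hdvd (ZMod ℓ) (f q ⟨σ, trivial⟩).toAdd * e q = 0 := by
          rw [← he fun q ↦ ZMod.castHom hdvd (ZMod ℓ) (f q ⟨σ, trivial⟩).toAdd]
          exact hle ⟨Additive.ofMul ⟨σ, trivial⟩, rfl⟩
        have hdiv : ℓ ∣ ∑ q, (f q ⟨σ, trivial⟩).toAdd.val * (e q).val := by
          rw [← ZMod.natCast_eq_zero_iff, ← hσ]
          simp
        obtain ⟨w, hw⟩ := hdiv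
        have h₁ (q) : σ (y q) = j (C ζ) ^ (f q ⟨σ, trivial⟩).toAdd.val * y q :=
          hf q ⟨σ, trivial⟩
        simp only [u, map_prod, map_pow, h₁, mul_pow, Finset.prod_mul_distrib, ← pow_mul,
          Finset.prod_pow_eq_pow_sum]
        have h₂ : ∑ q, (f q ⟨σ, trivial⟩).toAdd.val * (n / ℓ * (e q).val) = n * w := by
          simp only [mul_left_comm _ (n / ℓ)]
          rw [← Finset.mul_sum, hw, ← mul_assoc, Nat.div_mul_cancel hdvd]
        rw [h₂, pow_mul, hζ'.pow_eq_one, one_pow, one_mul]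
      obtain ⟨u', hu'⟩ := IntermediateField.mem_bot.mp ((InfiniteGalois.mem_bot_iff_fixed u).mpr hu)
      have huℓ : u' ^ ℓ = algebraMap k[X] F (∏ q, (X - C (κ q)) ^ (e q).val) := by
        refine (algebraMap F E).injective ?_
        rw [map_pow, hu', ← RingHom.comp_apply, ← hj, map_prod, ← Finset.prod_pow]
        refine Finset.prod_congr rfl fun q _ ↦ ?_
        rw [map_pow, ← hy, ← pow_mul, ← pow_mul, mul_right_comm, Nat.div_mul_cancel hdvd]
      obtain ⟨P, hP⟩ := IsIntegrallyClosed.exists_algebraMap_eq_of_isIntegral_pow hℓ.pos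
        (huℓ ▸ isIntegral_algebraMap)
      rw [← hP, ← map_pow] at huℓ
      have hPℓ := IsFractionRing.injective k[X] F huℓ
      have he₀ (q) : e q = 0 := by
        rw [← ZMod.val_eq_zero]
        exact Nat.eq_zero_of_dvd_of_lt (dvd_of_pow_eq_prod_X_sub_C_pow hκ hPℓ q) (ZMod.val_lt _)
      refine LinearMap.ext fun v ↦ ?_
      simp [he, he₀]
    have hx : x ∈ AddSubgroup.toZModSubmodule ℓ H := hH ▸ Submodule.mem_top
    obtain ⟨τ, hτ⟩ := hx
    exact ⟨τ.toMul, fun q ↦ congrFun hτ q⟩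
  obtain ⟨σ, hσ⟩ := hsurj fun q ↦ Multiplicative.ofAdd (a q)
  refine ⟨σ, fun q ↦ ?_⟩
  rw [hf q σ]
  have : f q σ = Multiplicative.ofAdd (a q) := congrFun hσ q
  rw [this]
  rfl

theorem IsPrimitiveRoot.fintypeCard_rootsOfUnity {k : Type*} [CommRing k] [IsDomain k] {n : ℕ}
    [NeZero n] {ζ : k} (hζ : IsPrimitiveRoot ζ n) : Fintype.card (rootsOfUnity n k) = n := by
  rw [← Nat.card_eq_fintype_card, hζ.card_rootsOfUnity]

theorem natDegree_prodRootsOfUnity {Q k T : Type*} [Fintype Q] [DecidableEq Q] [CommRing k]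
    [IsDomain k] [CommRing T] [Nontrivial T] {n : ℕ} [NeZero n] {ζ : k} (hζ : IsPrimitiveRoot ζ n)
    (j : k →+* T) (y : Q → T) :
    (prodRootsOfUnity n j y).natDegree = n ^ Fintype.card Q := by
  rw [prodRootsOfUnity, natDegree_prod_of_monic _ _ fun v _ ↦ monic_X_sub_C _]
  simp only [natDegree_X_sub_C, Finset.sum_const, Finset.card_univ, Fintype.card_fun,
    hζ.fintypeCard_rootsOfUnity, smul_eq_mul, mul_one]

theorem irreducible_of_map_eq_prodRootsOfUnity {k k' Q : Type*} [Field k] [Field k']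
    [Fintype Q] [DecidableEq Q] {n : ℕ} [NeZero n] {ζ : k} (hζ : IsPrimitiveRoot ζ n)
    (i : k →+* k') {κ : Q → k'} (hκ : Function.Injective κ)
    {F E : Type*} [Field F] [Algebra k'[X] F] [IsFractionRing k'[X] F] [Field E] [Algebra F E]
    [IsGalois F E] (j : k'[X] →+* E) (hj : j = (algebraMap F E).comp (algebraMap k'[X] F))
    {y : Q → E} (hy : ∀ q, y q ^ n = j (X - C (κ q))) {f : k'[X][X]} (hf : f.Monic)
    (h : f.map j = prodRootsOfUnity n (j.comp (C.comp i)) y) : Irreducible f := by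
  have hjinj : Function.Injective j := by
    rw [hj, RingHom.coe_comp]
    exact (algebraMap F E).injective.comp (IsFractionRing.injective k'[X] F)
  have hjσ (σ : E ≃ₐ[F] E) (P : k'[X]) : σ (j P) = j P := by
    rw [hj]
    exact σ.commutes _
  have hjC : Function.Injective (j.comp (C.comp i)) := (j.comp (C.comp i)).injective
  have hy₀ (q) : y q ≠ 0 := by
    intro h
    have := hy q
    rw [h, zero_pow (NeZero.ne n), eq_comm, map_eq_zero_iff _ hjinj] at this
    exact X_sub_C_ne_zero _ this
  have hζ' : IsPrimitiveRoot (i ζ) n := hζ.map_of_injective i.injective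
  have hgal := exists_algEquiv_kummer hζ' hκ j hj hy
  let z (ε : Q → rootsOfUnity n k) : E := ∑ q, j (C (i ((ε q : kˣ) : k))) * y q
  have hz : Function.Injective z := by
    intro ε ε' hεε'
    by_contra hne
    obtain ⟨q, hq⟩ := Function.ne_iff.mp hne
    obtain ⟨σ, hσ⟩ := hgal (Pi.single q 1)
    have hdiff (ε : Q → rootsOfUnity n k) : σ (z ε) - z ε =
        j (C (i ((ε q : kˣ) : k))) * (j (C (i ζ)) ^ (1 : ZMod n).val - 1) * y q := by
      simp only [z, map_sum, map_mul, hjσ, hσ]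
      rw [← Finset.sum_sub_distrib, Finset.sum_eq_single q]
      · rw [Pi.single_eq_same]
        ring
      · intro q' _ hq'
        rw [Pi.single_eq_of_ne hq', ZMod.val_zero, pow_zero, one_mul, sub_self]
      · simp
    have h₁ := hdiff ε
    rw [hεε', hdiff ε'] at h₁
    have h₂ := mul_right_cancel₀ (hy₀ q) h₁
    have h₃ : j (C (i ζ)) ^ (1 : ZMod n).val - 1 ≠ 0 := by
      intro h₀
      have hn := Nat.eq_zero_of_dvd_of_lt
        (((hζ.map_of_injective hjC).pow_eq_one_iff_dvd _).mp (sub_eq_zero.mp h₀)) (ZMod.val_lt _)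
      rw [ZMod.val_eq_zero, ZMod.one_eq_zero_iff] at hn
      subst hn
      exact hq (Subsingleton.elim _ _)
    exact hq (Subtype.ext (Units.ext (hjC (mul_right_cancel₀ h₃ h₂)).symm))
  have htrans (ε : Q → rootsOfUnity n k) : ∃ σ : E ≃ₐ[F] E, σ (z 1) = z ε := by
    have hε (q) : ∃ a : ZMod n, ζ ^ a.val = ((ε q : kˣ) : k) := by
      obtain ⟨m, hm, h⟩ := hζ.eq_pow_of_pow_eq_one ((mem_rootsOfUnity' n _).mp (ε q).2)
      exact ⟨m, by rw [ZMod.val_natCast_of_lt hm, h]⟩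
    choose a ha using hε
    obtain ⟨σ, hσ⟩ := hgal a
    refine ⟨σ, ?_⟩
    simp only [z, map_sum, map_mul, hjσ, hσ, ← ha]
    simp
  rw [hf.irreducible_iff_irreducible_map_fraction_map (K := F)]
  have hroot (ε) : aeval (z ε) (f.map (algebraMap k'[X] F)) = 0 := by
    rw [aeval_def, ← eval_map, Polynomial.map_map, ← hj, h, prodRootsOfUnity, eval_prod]
    exact Finset.prod_eq_zero (Finset.mem_univ ε) (by
      rw [eval_sub, eval_X, eval_C]
      exact sub_self _)
  have h_int : IsIntegral F (z 1) := ⟨_, hf.map _, hroot 1⟩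
  have hcard : n ^ Fintype.card Q ≤ (minpoly F (z 1)).natDegree := by
    rw [← natDegree_map (algebraMap F E)]
    have hsub : (Finset.univ.map ⟨z, hz⟩).val ⊆ ((minpoly F (z 1)).map (algebraMap F E)).roots := by
      intro w hw
      obtain ⟨ε, -, rfl⟩ := Finset.mem_map.mp hw
      obtain ⟨σ, hσ⟩ := htrans ε
      refine (mem_roots ((minpoly.monic h_int).map _).ne_zero).mpr ?_
      rw [IsRoot.def, eval_map, ← aeval_def]
      change aeval (z ε) _ = 0
      rw [← hσ, aeval_algHom_apply, minpoly.aeval, map_zero]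
    refine le_of_eq_of_le ?_ (card_le_degree_of_subset_roots hsub)
    rw [Finset.card_map, Finset.card_univ, Fintype.card_fun, hζ.fintypeCard_rootsOfUnity]
  have hdeg : (f.map (algebraMap k'[X] F)).natDegree = n ^ Fintype.card Q := by
    rw [← natDegree_map (algebraMap F E), Polynomial.map_map, ← hj, h,
      natDegree_prodRootsOfUnity hζ]
  have heq := eq_of_monic_of_dvd_of_natDegree_le (minpoly.monic h_int) (hf.map _)
    (minpoly.dvd F _ (hroot 1)) (hdeg.trans_le hcard)
  rw [heq]
  exact minpoly.irreducible h_int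

theorem eval_prodRootsOfUnity_eq_zero {Q k T : Type*} [Fintype Q] [DecidableEq Q] [CommRing k]
    [IsDomain k] [CommRing T] [IsDomain T] {n : ℕ} [NeZero n] {j : k →+* T} {y : Q → T} {b : T}
    (h : (prodRootsOfUnity n j y).eval b = 0) :
    ∃ ε : Q → rootsOfUnity n k, b = ∑ q, j ((ε q : kˣ) : k) * y q := by
  rw [prodRootsOfUnity, eval_prod, Finset.prod_eq_zero_iff] at h
  obtain ⟨ε, -, h⟩ := h
  rw [eval_sub, eval_X, eval_C, sub_eq_zero] at h
  exact ⟨ε, h⟩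

theorem exists_radical_family {K : Type} [Field K] (n : ℕ) [NeZero n] [NeZero (n : K)] {Q : Type}
    [Fintype Q] [MulAction (SeparableClosure K ≃ₐ[K] SeparableClosure K) Q]
    {κ : Q → SeparableClosure K} (hinj : Function.Injective κ)
    (hκ : ∀ (σ : SeparableClosure K ≃ₐ[K] SeparableClosure K) q, κ (σ • q) = σ (κ q)) :
    ∃ f : K[X][X], f.Monic ∧ f.natDegree = n ^ Fintype.card Q ∧
      Irreducible (f.map (mapRingHom (algebraMap K (AlgebraicClosure K)))) ∧
      f.derivative ≠ 0 ∧
      (∀ a (b : AlgebraicClosure K), aeval b (f.map (evalRingHom a)) = 0 → IsSeparable K b) ∧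
      ∀ a (b : SeparableClosure K) (y : Q → SeparableClosure K),
        (∀ q, y q ^ n = algebraMap K (SeparableClosure K) a - κ q) →
        aeval b (f.map (evalRingHom a)) = 0 →
        ∃ ε : Q → SeparableClosure K, (∀ q, ε q ^ n = 1) ∧ b = ∑ q, ε q * y q := by
  classical
  have hnk : NeZero (n : SeparableClosure K) :=
    ⟨by rw [← map_natCast (algebraMap K (SeparableClosure K))]
        exact (_root_.map_ne_zero _).mpr (NeZero.ne (n : K))⟩
  obtain ⟨ζ, hζ⟩ := HasEnoughRootsOfUnity.exists_primitiveRoot (SeparableClosure K) n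
  obtain ⟨f, hf, hmap⟩ := exists_monic_map_eq_prodRootsOfUnity hζ κ hκ
  have hspec (a : K) (y : Q → SeparableClosure K)
      (hy : ∀ q, y q ^ n = algebraMap K (SeparableClosure K) a - κ q) :
      (f.map (evalRingHom a)).map (algebraMap K (SeparableClosure K)) =
        prodRootsOfUnity n (RingHom.id (SeparableClosure K)) y := by
    convert hmap (evalRingHom (algebraMap K (SeparableClosure K) a)) y (by simpa using hy) using 1
    · rw [Polynomial.map_map]
      congr 1
      ext <;> simp
    · congr 1
      ext
      simp
  let i := algebraMap (SeparableClosure K) (AlgebraicClosure K)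
  let F := FractionRing (AlgebraicClosure K)[X]
  let E := SeparableClosure F
  let j : (AlgebraicClosure K)[X] →+* E := (algebraMap F E).comp (algebraMap _ F)
  have hnE : NeZero (n : E) :=
    ⟨by rw [← map_natCast (j.comp (C.comp (algebraMap K (AlgebraicClosure K))))]
        exact (_root_.map_ne_zero _).mpr (NeZero.ne (n : K))⟩
  choose y hy using fun q ↦ IsSepClosed.exists_pow_nat_eq (j (X - C (i (κ q)))) n
  have hprod : (f.map (mapRingHom (algebraMap K (AlgebraicClosure K)))).map j =
      prodRootsOfUnity n (j.comp (C.comp i)) y := by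
    convert hmap (j.comp (mapRingHom i)) y (by simpa using hy) using 1
    · rw [Polynomial.map_map, IsScalarTower.algebraMap_eq K (SeparableClosure K), ← mapRingHom_comp,
        RingHom.comp_assoc]
      rfl
    · congr 1
      ext
      simp
  have hdeg : f.natDegree = n ^ Fintype.card Q := by
    rw [← natDegree_prodRootsOfUnity hζ (j.comp (C.comp i)) y, ← hprod, (hf.map _).natDegree_map,
      hf.natDegree_map]
  refine ⟨f, hf, hdeg, ?_, ?_, ?_, ?_⟩
  · exact irreducible_of_map_eq_prodRootsOfUnity hζ i (i.injective.comp hinj) j rfl hy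
      (hf.map _) hprod
  · intro h
    have h₁ := coeff_derivative f (n ^ Fintype.card Q - 1)
    rw [h, coeff_zero, Nat.sub_add_cancel (Nat.one_le_pow _ _ (NeZero.pos n)), ← hdeg,
      hf.coeff_natDegree, one_mul] at h₁
    have h₂ : ((n ^ Fintype.card Q : ℕ) : K[X]) = 0 := by
      rw [h₁, hdeg, ← Nat.cast_add_one, Nat.sub_add_cancel (Nat.one_le_pow _ _ (NeZero.pos n))]
    rw [← C_eq_natCast, C_eq_zero, Nat.cast_pow] at h₂
    exact pow_ne_zero _ (NeZero.ne (n : K)) h₂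
  · intro a b hb
    choose y hy using fun q ↦ IsSepClosed.exists_pow_nat_eq
      (algebraMap K (SeparableClosure K) a - κ q) n
    have h₁ : ((f.map (evalRingHom a)).map (algebraMap K (AlgebraicClosure K))).eval b = 0 := by
      rwa [eval_map, ← aeval_def]
    rw [IsScalarTower.algebraMap_eq K (SeparableClosure K), ← Polynomial.map_map, hspec a y hy,
      map_prodRootsOfUnity] at h₁
    obtain ⟨ε, rfl⟩ := eval_prodRootsOfUnity_eq_zero h₁
    refine mem_separableClosure_iff.mp (SetLike.mem_coe.mp ?_)
    convert SetLike.coe_mem (∑ q, ((ε q : (SeparableClosure K)ˣ) : SeparableClosure K) * y q)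
    simp
  · intro a b y hy hb
    rw [aeval_def, ← eval_map, hspec a y hy] at hb
    obtain ⟨ε, rfl⟩ := eval_prodRootsOfUnity_eq_zero hb
    exact ⟨fun q ↦ ((ε q : (SeparableClosure K)ˣ) : SeparableClosure K),
      fun q ↦ (mem_rootsOfUnity' n _).mp (ε q).2, rfl⟩

theorem quotient_out_smul_apply {K E : Type*} [Field K] [Field E] [Algebra K E]
    {N : Subgroup (E ≃ₐ[K] E)} {x : E} (hx : ∀ τ ∈ N, τ x = x) (σ : E ≃ₐ[K] E) :
    (QuotientGroup.mk σ : (E ≃ₐ[K] E) ⧸ N).out x = σ x := by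
  obtain ⟨τ, hτ⟩ := QuotientGroup.mk_out_eq_mul N σ
  rw [hτ, AlgEquiv.mul_apply, hx τ τ.2]

theorem IsFullyHilbertian.exists_conjIndependent_of_neZero {K : Type} [Field K] [Infinite K]
    (hK : IsFullyHilbertian K) (n : ℕ) [NeZero n] [NeZero (n : K)]
    (L : IntermediateField K (SeparableClosure K)) [FiniteDimensional K L] [IsGalois K L]
    [L.fixingSubgroup.FiniteIndex] [L.fixingSubgroup.Normal] {ζ : SeparableClosure K}
    (hζ : IsPrimitiveRoot ζ n) (hζL : ζ ∈ L)
    {I : Type} (hI : Cardinal.mk I = Cardinal.mk K) :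
    ∃ ψ : I → L.fixingSubgroup →* Multiplicative (ZMod n),
      ConjIndependent L.fixingSubgroup ψ ∧
      ∀ i, ∃ s : Finset (SeparableClosure K), ∀ τ : L.fixingSubgroup,
        (∀ x ∈ s, (τ : SeparableClosure K ≃ₐ[K] SeparableClosure K) x = x) → ψ i τ = 1 := by
  classical
  have := Fintype.ofFinite ((SeparableClosure K ≃ₐ[K] SeparableClosure K) ⧸ L.fixingSubgroup)
  have hnk : NeZero (n : SeparableClosure K) :=
    ⟨by rw [← map_natCast (algebraMap K (SeparableClosure K))]
        exact (_root_.map_ne_zero _).mpr (NeZero.ne (n : K))⟩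
  obtain ⟨c, hc⟩ := Field.exists_primitive_element K L
  have hfix {x : SeparableClosure K} (hx : x ∈ L)
      (τ : SeparableClosure K ≃ₐ[K] SeparableClosure K) (hτ : τ ∈ L.fixingSubgroup) : τ x = x :=
    hτ ⟨x, hx⟩
  have hc' (τ : SeparableClosure K ≃ₐ[K] SeparableClosure K) (hτ : τ c = c) :
      τ ∈ L.fixingSubgroup := by
    have : L = IntermediateField.adjoin K {(c : SeparableClosure K)} := by
      have := congrArg IntermediateField.lift hc
      rw [IntermediateField.lift_adjoin_simple, IntermediateField.lift_top] at this
      exact this.symm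
    rw [this, fixingSubgroup_adjoin_simple]
    exact hτ
  let κ (q : (SeparableClosure K ≃ₐ[K] SeparableClosure K) ⧸ L.fixingSubgroup) :
    SeparableClosure K := q.out c
  have hκ (σ : SeparableClosure K ≃ₐ[K] SeparableClosure K) (q) : κ (σ • q) = σ (κ q) := by
    induction q using QuotientGroup.induction_on with
    | H g =>
      change (QuotientGroup.mk (σ * g) : _ ⧸ L.fixingSubgroup).out (c : SeparableClosure K) = _
      simp only [κ]
      rw [quotient_out_smul_apply (hfix c.2), quotient_out_smul_apply (hfix c.2),
        AlgEquiv.mul_apply]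
  have hinj : Function.Injective κ := by
    intro q q' h
    rw [← q.out_eq', ← q'.out_eq', QuotientGroup.eq]
    refine hc' _ ?_
    rw [AlgEquiv.mul_apply]
    exact (congrArg _ h.symm).trans (AlgEquiv.symm_apply_apply q.out (c : SeparableClosure K))
  obtain ⟨f, hf, hdeg, hirr, hder, hsep, hroot⟩ := exists_radical_family n hinj hκ
  obtain ⟨a, b, hab, hrel⟩ := hK.exists_relIndex_eq L.fixingSubgroup hI f hf hirr hder hsep
  choose y hy using fun i ↦ IsSepClosed.exists_pow_nat_eq
    (algebraMap K (SeparableClosure K) (a i) - c) n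
  have hfixy (i : I) (τ) (hτ : τ ∈ L.fixingSubgroup) : τ (y i ^ n) = y i ^ n := by
    rw [hy, map_sub, AlgEquiv.commutes, hfix c.2 τ hτ]
  have hψ (i : I) : ∃ ψ : L.fixingSubgroup →* Multiplicative (ZMod n), ∀ τ : L.fixingSubgroup,
      ψ τ = 1 ↔ (τ : SeparableClosure K ≃ₐ[K] SeparableClosure K) (y i) = y i := by
    by_cases hy₀ : y i = 0
    · exact ⟨1, by simp [hy₀]⟩
    · obtain ⟨ψ, hψ⟩ := exists_kummerCharacter L.fixingSubgroup hζ (hfix hζL) hy₀ (hfixy i)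
      refine ⟨ψ, fun τ ↦ ?_⟩
      rw [hψ, mul_eq_right₀ hy₀, hζ.pow_eq_one_iff_dvd]
      constructor
      · intro h
        rw [h]
        simp
      · intro h
        have := Nat.eq_zero_of_dvd_of_lt h (ZMod.val_lt _)
        rw [ZMod.val_eq_zero] at this
        exact this
  choose ψ hψ using hψ
  refine ⟨ψ, ?_, fun i ↦ ⟨{y i}, fun τ h ↦ (hψ i τ).mpr (h _ (by simp))⟩⟩
  refine conjIndependent_of_relIndex ψ (fun i ↦ MulAction.stabilizer _ (b i)) ?_ ?_
  · intro S
    rw [hrel, hdeg]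
    simp
  · intro i τ hτ
    rw [MulAction.mem_stabilizer_iff, AlgEquiv.smul_def]
    obtain ⟨ε, hε, hb⟩ := hroot (a i) (b i) (fun q ↦ q.out (y i)) (fun q ↦ by
      rw [← map_pow, hy, map_sub, AlgEquiv.commutes]) (hab i)
    rw [hb, map_sum]
    refine Finset.sum_congr rfl fun q _ ↦ ?_
    rw [map_mul]
    congr 1
    · obtain ⟨m, -, h⟩ := hζ.eq_pow_of_pow_eq_one (hε q)
      exact hfix (h ▸ pow_mem hζL m) _ τ.2
    · have h := (hψ i _).mp (hτ q)
      rw [MulAut.conjNormal_apply, inv_inv, AlgEquiv.mul_apply, AlgEquiv.mul_apply] at h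
      have := congrArg q.out h
      rw [← AlgEquiv.mul_apply, mul_inv_cancel, AlgEquiv.one_apply] at this
      exact this

theorem IntermediateField.exists_isGalois_ge {K : Type} [Field K]
    (L₀ : IntermediateField K (SeparableClosure K)) [FiniteDimensional K L₀]
    (ζ : SeparableClosure K) : ∃ L : IntermediateField K (SeparableClosure K), L₀ ≤ L ∧ ζ ∈ L ∧
      FiniteDimensional K L ∧ IsGalois K L := by
  have hζ : IsIntegral K ζ := Algebra.IsIntegral.isIntegral ζ
  have := IntermediateField.adjoin.finiteDimensional hζ
  refine ⟨IntermediateField.normalClosure K ↥(L₀ ⊔ IntermediateField.adjoin K {ζ})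
    (SeparableClosure K), ?_, ?_, inferInstance, ?_⟩
  · exact le_sup_left.trans (IntermediateField.le_normalClosure _)
  · exact (le_sup_right.trans (IntermediateField.le_normalClosure _) :
      IntermediateField.adjoin K {ζ} ≤ _) (IntermediateField.mem_adjoin_simple_self K ζ)
  · exact { }

theorem IsFullyHilbertian.exists_conjIndependent {K : Type} [Field K]
    (hK : IsFullyHilbertian K) {n : ℕ} (hn : n ≠ 0)
    (L₀ : IntermediateField K (SeparableClosure K)) [FiniteDimensional K L₀]
    {I : Type} (hI : Cardinal.mk I = Cardinal.mk K) :
    ∃ (L : IntermediateField K (SeparableClosure K)) (_ : L.fixingSubgroup.Normal)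
      (ψ : I → L.fixingSubgroup →* Multiplicative (ZMod n)),
      FiniteDimensional K L ∧ L₀ ≤ L ∧ ConjIndependent L.fixingSubgroup ψ ∧
      ∀ i, ∃ s : Finset (SeparableClosure K), ∀ τ : L.fixingSubgroup,
        (∀ x ∈ s, (τ : SeparableClosure K ≃ₐ[K] SeparableClosure K) x = x) → ψ i τ = 1 := by
  classical
  have := hK.infinite
  have hfin (L : IntermediateField K (SeparableClosure K)) [FiniteDimensional K L] :
      L.fixingSubgroup.FiniteIndex :=
    ⟨by rw [← IntermediateField.finrank_eq_fixingSubgroup_index]; exact Module.finrank_pos.ne'⟩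
  have key {m : ℕ} (hm : (m : K) ≠ 0) : ∃ L : IntermediateField K (SeparableClosure K),
      FiniteDimensional K L ∧ IsGalois K L ∧ L₀ ≤ L ∧ ∃ (_ : L.fixingSubgroup.Normal)
        (ψ : I → L.fixingSubgroup →* Multiplicative (ZMod m)),
        ConjIndependent L.fixingSubgroup ψ ∧
        ∀ i, ∃ s : Finset (SeparableClosure K), ∀ τ : L.fixingSubgroup,
          (∀ x ∈ s, (τ : SeparableClosure K ≃ₐ[K] SeparableClosure K) x = x) → ψ i τ = 1 := by
    have : NeZero (m : K) := ⟨hm⟩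
    have : NeZero m := ⟨by rintro rfl; simp at hm⟩
    have : NeZero (m : SeparableClosure K) :=
      ⟨by rw [← map_natCast (algebraMap K (SeparableClosure K))]
          exact (_root_.map_ne_zero _).mpr hm⟩
    obtain ⟨ζ, hζ⟩ := HasEnoughRootsOfUnity.exists_primitiveRoot (SeparableClosure K) m
    obtain ⟨L, hL₀, hζL, hL, hL'⟩ := L₀.exists_isGalois_ge ζ
    have := hfin L
    exact ⟨L, hL, hL', hL₀, inferInstance, hK.exists_conjIndependent_of_neZero m L hζ hζL hI⟩
  obtain ⟨p, hp⟩ := CharP.exists K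
  by_cases hn' : (n : K) = 0
  · rw [CharP.cast_eq_zero_iff K p] at hn'
    have hp₀ : p ≠ 0 := by
      rintro rfl
      exact hn (zero_dvd_iff.mp hn')
    have hpp : Fact p.Prime := ⟨(CharP.char_is_prime_or_zero K p).resolve_right hp₀⟩
    obtain ⟨r, m, hpm, rfl⟩ := Nat.exists_eq_pow_mul_and_not_dvd hn p hpp.out.ne_one
    have hr : r ≠ 0 := by
      rintro rfl
      rw [pow_zero, one_mul] at hn'
      exact hpm hn'
    obtain ⟨L, hL, hL', hL₀, _, ψ₂, h₂, hs₂⟩ := key (mt (CharP.cast_eq_zero_iff K p m).mp hpm)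
    have := hfin L
    obtain ⟨ψ₁, h₁, hs₁⟩ := hK.exists_conjIndependent_of_charP p hr L hI
    have hcop : (p ^ r).Coprime m := ((Nat.Prime.coprime_iff_not_dvd hpp.out).mpr hpm).pow_left r
    refine ⟨L, _, _, hL, hL₀,
      ConjIndependent.chineseRemainder hcop ψ₁ ψ₂ h₁ h₂, fun i ↦ ?_⟩
    obtain ⟨s₁, hs₁⟩ := hs₁ i
    obtain ⟨s₂, hs₂⟩ := hs₂ i
    refine ⟨s₁ ∪ s₂, fun τ hτ ↦ ?_⟩
    simp only [MonoidHom.comp_apply, MonoidHom.prod_apply,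
      hs₁ τ fun x hx ↦ hτ x (Finset.mem_union_left _ hx),
      hs₂ τ fun x hx ↦ hτ x (Finset.mem_union_right _ hx)]
    rw [← Prod.one_eq_mk, map_one, map_one]
  · obtain ⟨L, hL, hL', hL₀, _, ψ, h, hs⟩ := key hn'
    exact ⟨L, _, ψ, hL, hL₀, h, hs⟩

theorem IsFullyHilbertian.exists_cocycles {K A : Type} [Field K] [CommGroup A] [Finite A]
    (hK : IsFullyHilbertian K) (L₀ : IntermediateField K (SeparableClosure K))
    [FiniteDimensional K L₀] (ρ : (SeparableClosure K ≃ₐ[K] SeparableClosure K) →* MulAut A)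
    (hρ : L₀.fixingSubgroup ≤ ρ.ker) :
    ∃ z : K → (SeparableClosure K ≃ₐ[K] SeparableClosure K) → A,
      (∀ k τ υ, z k (τ * υ) = z k τ * ρ τ (z k υ)) ∧
      (∀ k, ∃ L : IntermediateField K (SeparableClosure K), FiniteDimensional K L ∧
        ∀ τ ∈ L.fixingSubgroup, z k τ = 1) ∧
      ∀ (S : Finset K) (α : K → A), ∃ τ ∈ L₀.fixingSubgroup, ∀ k ∈ S, z k τ = α k := by
  classical
  have := hK.infinite
  have hI : Cardinal.mk (K × A) = Cardinal.mk K := by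
    rw [Cardinal.mk_prod, Cardinal.lift_id, Cardinal.lift_id]
    exact Cardinal.mul_eq_left (Cardinal.aleph0_le_mk K)
      ((Cardinal.lt_aleph0_of_finite A).le.trans (Cardinal.aleph0_le_mk K)) (Cardinal.mk_ne_zero A)
  obtain ⟨L, hL, ψ, hLfin, hL₀, hψ, hs⟩ :=
    hK.exists_conjIndependent (Nat.card_pos (α := A)).ne' L₀ hI
  obtain ⟨χ, hχ, hker⟩ := hψ.exists_of_zmod fun x ↦ pow_card_eq_one'
  have hind : L.fixingSubgroup.FiniteIndex :=
    ⟨by rw [← IntermediateField.finrank_eq_fixingSubgroup_index]; exact Module.finrank_pos.ne'⟩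
  have := Fintype.ofFinite ((SeparableClosure K ≃ₐ[K] SeparableClosure K) ⧸ L.fixingSubgroup)
  have hle := IntermediateField.fixingSubgroup_antitone hL₀
  refine ⟨fun k ↦ corestriction L.fixingSubgroup ρ (χ k),
    fun k ↦ corestriction_mul (χ k) (hle.trans hρ), fun k ↦ ?_, fun S α ↦ ?_⟩
  · choose s hs using fun a ↦ hs (k, a)
    have := Fintype.ofFinite A
    let T : Finset (SeparableClosure K) := Finset.univ.biUnion fun q :
      (SeparableClosure K ≃ₐ[K] SeparableClosure K) ⧸ L.fixingSubgroup ↦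
        (Finset.univ.biUnion s).image q.out
    have : FiniteDimensional K (IntermediateField.adjoin K (T : Set (SeparableClosure K))) :=
      IntermediateField.finiteDimensional_adjoin fun x _ ↦ Algebra.IsIntegral.isIntegral x
    refine ⟨L ⊔ IntermediateField.adjoin K (T : Set (SeparableClosure K)), inferInstance,
      fun τ hτ ↦ ?_⟩
    rw [IntermediateField.fixingSubgroup_sup] at hτ
    have h := corestriction_coe (ρ := ρ) (χ k) ⟨τ, hτ.1⟩
    refine h.trans (Finset.prod_eq_one fun q _ ↦ ?_)
    rw [hker, map_one]
    intro a
    refine hs a _ fun x hx ↦ ?_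
    have hx' : q.out x ∈ IntermediateField.adjoin K (T : Set (SeparableClosure K)) := by
      refine IntermediateField.subset_adjoin _ _ ?_
      simp only [T, Finset.coe_biUnion, Set.mem_iUnion, Finset.coe_image]
      exact ⟨q, Finset.mem_univ q, x, Set.mem_iUnion₂.mpr ⟨a, Finset.mem_univ a, hx⟩, rfl⟩
    rw [MulAut.conjNormal_apply, inv_inv, AlgEquiv.mul_apply, AlgEquiv.mul_apply]
    have : τ (q.out x) = q.out x := hτ.2 ⟨_, hx'⟩
    rw [this]
    exact AlgEquiv.symm_apply_apply q.out x
  · obtain ⟨τ, hτ⟩ := exists_corestriction_eq (ρ := ρ) χ hχ S α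
    exact ⟨τ, hle τ.2, hτ⟩

theorem AlgEquiv.continuous_autCongr {K E E' : Type*} [Field K] [Field E] [Field E'] [Algebra K E]
    [Algebra K E'] (φ : E ≃ₐ[K] E') : Continuous (AlgEquiv.autCongr φ) := by
  refine continuous_of_continuousAt_one _ (continuousAt_def.mpr fun U hU ↦ ?_)
  rw [map_one, krullTopology_mem_nhds_one_iff] at hU
  obtain ⟨L, hL, hLU⟩ := hU
  rw [krullTopology_mem_nhds_one_iff]
  refine ⟨L.map φ.symm.toAlgHom,
    Module.Finite.equiv (IntermediateField.equivMap L φ.symm.toAlgHom).toLinearEquiv,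
    fun σ hσ ↦ hLU fun x ↦ ?_⟩
  have : σ (φ.symm x) = φ.symm x := hσ ⟨φ.symm x, x, x.2, rfl⟩
  change φ (σ (φ.symm x)) = x
  rw [this, AlgEquiv.apply_symm_apply]

theorem exists_intermediateField_of_surjective {K H : Type*} [Field K] [Group H]
    [TopologicalSpace H] [T1Space H] (Ψ : (SeparableClosure K ≃ₐ[K] SeparableClosure K) →* H)
    (hΨ : Continuous Ψ) (hsurj : Function.Surjective Ψ) :
    ∃ M : IntermediateField K (AlgebraicClosure K), IsGalois K M ∧
      ∃ e : (M ≃ₐ[K] M) ≃* H, Continuous e := by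
  let C : ClosedSubgroup (SeparableClosure K ≃ₐ[K] SeparableClosure K) :=
    ⟨Ψ.ker, (isClosed_singleton (x := (1 : H))).preimage hΨ⟩
  let M : IntermediateField K (SeparableClosure K) := IntermediateField.fixedField Ψ.ker
  have hM : M.fixingSubgroup = Ψ.ker := InfiniteGalois.fixingSubgroup_fixedField C
  have : IsGalois K M := by
    rw [← InfiniteGalois.normal_iff_isGalois, hM]
    infer_instance
  have hker : (AlgEquiv.restrictNormalHom (F := K) (K₁ := SeparableClosure K) M).ker = Ψ.ker := by
    rw [IntermediateField.restrictNormalHom_ker, hM]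
  have hres : Function.Surjective
      (AlgEquiv.restrictNormalHom (F := K) (K₁ := SeparableClosure K) M) :=
    AlgEquiv.restrictNormalHom_surjective _
  let e : (M ≃ₐ[K] M) ≃* H :=
    ((QuotientGroup.quotientKerEquivOfSurjective _ hres).symm.trans
      (QuotientGroup.quotientMulEquivOfEq hker)).trans
      (QuotientGroup.quotientKerEquivOfSurjective Ψ hsurj)
  have he : e ∘ AlgEquiv.restrictNormalHom (F := K) (K₁ := SeparableClosure K) M = Ψ := by
    ext σ
    have : (QuotientGroup.quotientKerEquivOfSurjective _ hres).symm
        (AlgEquiv.restrictNormalHom (F := K) (K₁ := SeparableClosure K) M σ) = σ := by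
      rw [MulEquiv.symm_apply_eq]
      rfl
    simp only [e, Function.comp_apply, MulEquiv.trans_apply, this]
    rfl
  have hcont := InfiniteGalois.restrictNormalHom_continuous M
  have hecont : Continuous e := by
    rw [(hcont.isClosedMap.isQuotientMap hcont hres).continuous_iff, he]
    exact hΨ
  let f := IntermediateField.liftAlgEquiv M
  exact ⟨IntermediateField.lift M, IsGalois.of_algEquiv f, (AlgEquiv.autCongr f.symm).trans e,
    hecont.comp (AlgEquiv.continuous_autCongr _)⟩

theorem continuous_of_fixingSubgroup {K E X : Type*} [Field K] [Field E] [Algebra K E]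
    [TopologicalSpace X] {f : (E ≃ₐ[K] E) → X} (L : IntermediateField K E)
    [FiniteDimensional K L] (h : ∀ σ, ∀ τ ∈ L.fixingSubgroup, f (σ * τ) = f σ) :
    Continuous f := by
  refine IsLocallyConstant.continuous ((IsLocallyConstant.iff_exists_open f).mpr fun σ ↦
    ⟨(σ⁻¹ * ·) ⁻¹' (L.fixingSubgroup : Set (E ≃ₐ[K] E)),
      L.fixingSubgroup_isOpen.preimage (continuous_const_mul _), ?_, fun τ hτ ↦ ?_⟩)
  · simp
  · rw [← h σ _ hτ, mul_inv_cancel_left]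

/-- `A ^ K ⋊ Gal(L/K)` occurs as a Galois group over a fully Hilbertian field `K`. -/
theorem IsFullyHilbertian.exists_semidirectProduct {K L A : Type} [Field K] [Field L] [Algebra K L]
    [IsGalois K L] [FiniteDimensional K L] [CommGroup A] [Finite A]
    (hK : IsFullyHilbertian K) (φ₀ : (L ≃ₐ[K] L) →* MulAut A) :
    ∃ M : IntermediateField K (AlgebraicClosure K), IsGalois K ↥M ∧
      ∃ e : (↥M ≃ₐ[K] ↥M) ≃* ((K → A) ⋊[piAut K φ₀] (L ≃ₐ[K] L)),
        @Continuous _ _ _ (sdTop K (piAut K φ₀)) e := by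
  let f : L →ₐ[K] SeparableClosure K := IsSepClosed.lift
  algebraize [f.toRingHom]
  have : IsScalarTower K L (SeparableClosure K) := IsScalarTower.of_algHom f
  let π := AlgEquiv.restrictNormalHom (F := K) (K₁ := SeparableClosure K) L
  have hπ : Function.Surjective π := AlgEquiv.restrictNormalHom_surjective _
  have : FiniteDimensional K f.fieldRange :=
    Module.Finite.equiv (AlgEquiv.ofInjectiveField f).toLinearEquiv
  have hker : ∀ τ ∈ f.fieldRange.fixingSubgroup, π τ = 1 := by
    intro τ hτ
    ext x
    refine f.injective ?_
    exact (AlgEquiv.restrictNormal_commutes τ L x).trans (hτ ⟨f x, x, rfl⟩)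
  obtain ⟨z, hz, hzc, hzs⟩ := hK.exists_cocycles f.fieldRange (φ₀.comp π) fun τ hτ ↦ by
    rw [MonoidHom.mem_ker, MonoidHom.comp_apply, hker τ hτ, map_one]
  let Ψ : (SeparableClosure K ≃ₐ[K] SeparableClosure K) →* (K → A) ⋊[piAut K φ₀] (L ≃ₐ[K] L) :=
    MonoidHom.mk' (fun τ ↦ ⟨fun k ↦ z k τ, π τ⟩) fun τ υ ↦ by
      refine SemidirectProduct.ext (funext fun k ↦ hz k τ υ) (map_mul π τ υ)
  let _ : TopologicalSpace A := ⊥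
  have : DiscreteTopology A := ⟨rfl⟩
  let _ : TopologicalSpace ((K → A) ⋊[piAut K φ₀] (L ≃ₐ[K] L)) := sdTop K (piAut K φ₀)
  have hinj : Function.Injective
      fun p : (K → A) ⋊[piAut K φ₀] (L ≃ₐ[K] L) ↦ (p.left, p.right) :=
    fun p q h ↦ SemidirectProduct.ext (congrArg Prod.fst h) (congrArg Prod.snd h)
  have hemb : Topology.IsEmbedding
      fun p : (K → A) ⋊[piAut K φ₀] (L ≃ₐ[K] L) ↦ (p.left, p.right) := ⟨⟨rfl⟩, hinj⟩
  have := krullTopology_t2 (K := K) (L := L)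
  have := hemb.t2Space
  have hπc : Continuous π := continuous_of_fixingSubgroup f.fieldRange fun σ τ hτ ↦ by
    rw [map_mul, hker τ hτ, mul_one]
  have hzcont (k : K) : Continuous (z k) := by
    obtain ⟨L', hL', h⟩ := hzc k
    exact continuous_of_fixingSubgroup L' fun σ τ hτ ↦ by rw [hz, h τ hτ, map_one, mul_one]
  have hΨ : Continuous Ψ :=
    hemb.continuous_iff.mpr ((continuous_pi hzcont).prodMk hπc)
  refine exists_intermediateField_of_surjective Ψ hΨ fun p ↦ ?_
  obtain ⟨τ, hτ⟩ := CompactSpace.iInter_nonempty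
    (t := fun k : K ↦ (fun τ ↦ (z k τ, π τ)) ⁻¹' {(p.left k, p.right)})
    (fun k ↦ isClosed_singleton.preimage ((hzcont k).prodMk hπc)) fun S ↦ by
      obtain ⟨σ, hσ⟩ := hπ p.right
      obtain ⟨τ, hτ, hτS⟩ := hzs S fun k ↦ p.left k * (z k σ)⁻¹
      refine ⟨τ * σ, Set.mem_iInter₂.mpr fun k hk ↦ Prod.ext ?_ ?_⟩
      · change z k (τ * σ) = p.left k
        rw [hz, hτS k hk, MonoidHom.comp_apply, hker τ hτ, map_one, MulAut.one_apply,
          inv_mul_cancel_right]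
      · change π (τ * σ) = p.right
        rw [map_mul, hker τ hτ, one_mul, hσ]
  rw [Set.mem_iInter] at hτ
  exact ⟨τ, SemidirectProduct.ext (funext fun k ↦ congrArg Prod.fst (hτ k))
    (congrArg Prod.snd (hτ 0))⟩

/-- Let `K` be a fully Hilbertian field (of cardinality `m = |K|`),
`A` a finite abelian group, `L/K` a finite Galois extension with group `G = Gal(L/K)`
acting on `A` via `φ₀`.  Then `A^m ⋊ G` (with `G` acting coordinatewise, `m = |K|`
realized by indexing with `K`) occurs as a Galois group over `K`, i.e. there is a Galois
extension `M/K` whose Galois group is topologically isomorphic to `A^m ⋊ G`.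
In particular `A^m` occurs as a Galois group over `K`. -/
theorem fullyHilbertian_realizes_semidirect_power
    (K L A : Type) [Field K] [Field L] [Algebra K L] [IsGalois K L]
    [FiniteDimensional K L] [CommGroup A] [Finite A]
    (hK : IsFullyHilbertian K) (φ₀ : (L ≃ₐ[K] L) →* MulAut A) :
    (∃ M : IntermediateField K (AlgebraicClosure K), IsGalois K ↥M ∧
      ∃ e : (↥M ≃ₐ[K] ↥M) ≃* ((K → A) ⋊[piAut K φ₀] (L ≃ₐ[K] L)),
        @Continuous _ _ _ (sdTop K (piAut K φ₀)) e) ∧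
    (∃ M : IntermediateField K (AlgebraicClosure K), IsGalois K ↥M ∧
      ∃ e : (↥M ≃ₐ[K] ↥M) ≃* (K → A),
        @Continuous _ _ _ (@Pi.topologicalSpace K (fun _ => A) (fun _ => ⊥)) e) := by
  refine ⟨hK.exists_semidirectProduct φ₀, ?_⟩
  obtain ⟨M, hM, e, he⟩ := hK.exists_semidirectProduct (1 : (K ≃ₐ[K] K) →* MulAut A)
  let _ : TopologicalSpace A := ⊥
  let _ := sdTop K (piAut K (1 : (K ≃ₐ[K] K) →* MulAut A))
  let l : (K → A) ⋊[piAut K (1 : (K ≃ₐ[K] K) →* MulAut A)] (K ≃ₐ[K] K) ≃* (K → A) :=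
    { toFun p := p.left
      invFun v := ⟨v, 1⟩
      left_inv p := SemidirectProduct.ext rfl (Subsingleton.elim _ _)
      right_inv _ := rfl
      map_mul' _ _ := rfl }
  have hl : Continuous l :=
    continuous_fst.comp (continuous_induced_dom (f := fun p :
      (K → A) ⋊[piAut K (1 : (K ≃ₐ[K] K) →* MulAut A)] (K ≃ₐ[K] K) ↦ (p.left, p.right)))
  exact ⟨M, hM, e.trans l, hl.comp he⟩
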